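/- arXiv:1310.0129 — 2 statements merged into one kernel-verified Lean document; each statement's English description precedes it below -/
import Mathlib

section
/- For any five-party pure quantum state ψ on systems A, B₁, E₁, B₂, E₂ (all finite-dimensional), the squashed entanglement satisfies the subadditivity inequality E_sq(A; B₁B₂) ≤ E_sq(AB₂E₂; B₁) + E_sq(AB₁E₁; B₂). -/
open Matrix BigOperators
open scoped Kronecker

/-- von Neumann entropy (in bits) of a Hermitian matrix, via its eigenvalues. -/
noncomputable def vnH {n : Type} [Fintype n] [DecidableEq n] (ρ : Matrix n n ℂ) : ℝ :=
  if h : ρ.IsHermitian then -∑ i, (h.eigenvalues i) * Real.logb 2 (h.eigenvalues i) else 0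

/-- Partial trace over the first tensor factor. -/
noncomputable def ptFst {α β : Type} [Fintype α] (ρ : Matrix (α × β) (α × β) ℂ) :
    Matrix β β ℂ := Matrix.of fun i j => ∑ k, ρ (k, i) (k, j)

/-- Partial trace over the second tensor factor. -/
noncomputable def ptSnd {α β : Type} [Fintype β] (ρ : Matrix (α × β) (α × β) ℂ) :
    Matrix α α ℂ := Matrix.of fun i j => ∑ k, ρ (i, k) (j, k)

/-- Partial trace over the middle tensor factor of a tripartite system. -/
noncomputable def ptMid {α β γ : Type} [Fintype β]
    (ρ : Matrix (α × β × γ) (α × β × γ) ℂ) : Matrix (α × γ) (α × γ) ℂ :=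
  Matrix.of fun i j => ∑ k, ρ (i.1, k, i.2) (j.1, k, j.2)

/-- Conditional quantum mutual information I(A;B|E) = H(AE) + H(BE) - H(ABE) - H(E)
for a state on `α × β × ε`. -/
noncomputable def cmi {α β ε : Type} [Fintype α] [Fintype β] [Fintype ε]
    [DecidableEq α] [DecidableEq β] [DecidableEq ε]
    (ρ : Matrix (α × β × ε) (α × β × ε) ℂ) : ℝ :=
  vnH (ptMid ρ) + vnH (ptFst ρ) - vnH ρ - vnH (ptFst (ptFst ρ))

/-- The rank-one (pure-state) density matrix |ψ⟩⟨ψ|. -/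
noncomputable def pureMat {n : Type} (ψ : n → ℂ) : Matrix n n ℂ :=
  Matrix.of fun i j => ψ i * star (ψ j)

/-- A quantum channel presented by Kraus operators. -/
structure Kraus (ι κ : Type) [Fintype ι] [Fintype κ] [DecidableEq ι] where
  R : Type
  fintypeR : Fintype R
  K : R → Matrix κ ι ℂ
  tp : (∑ i : R, (K i)ᴴ * K i) = (1 : Matrix ι ι ℂ)

attribute [instance] Kraus.fintypeR

/-- Apply a squashing channel to the purifying system `E` of a state on `(A × B) × E`,
recording the output on `A × (B × E')`. -/
noncomputable def squash {A B : Type} [Fintype A] [Fintype B] [DecidableEq A] [DecidableEq B]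
    {e e' : ℕ} (ρ : Matrix ((A × B) × Fin e) ((A × B) × Fin e) ℂ) (S : Kraus (Fin e) (Fin e')) :
    Matrix (A × B × Fin e') (A × B × Fin e') ℂ :=
  (∑ i : S.R, ((1 : Matrix (A × B) (A × B) ℂ) ⊗ₖ S.K i) * ρ *
      ((1 : Matrix (A × B) (A × B) ℂ) ⊗ₖ S.K i)ᴴ).submatrix
    (Equiv.prodAssoc A B (Fin e')).symm (Equiv.prodAssoc A B (Fin e')).symm

/-- Squashed entanglement of a bipartite state:
`(1/2)` times the infimum of `I(A;B|E')` over purifications and squashing channels. -/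
noncomputable def EsqState {A B : Type} [Fintype A] [Fintype B] [DecidableEq A] [DecidableEq B]
    (ρ : Matrix (A × B) (A × B) ℂ) : ℝ :=
  (1 / 2) * sInf { x : ℝ | ∃ (e : ℕ) (ψ : (A × B) × Fin e → ℂ),
    ptSnd (pureMat ψ) = ρ ∧ ∃ (e' : ℕ) (S : Kraus (Fin e) (Fin e')),
      x = cmi (squash (pureMat ψ) S) }


lemma G_mono_real {I J : Type} [Fintype I] [Fintype J] (w : I → J → ℝ) (p : J → ℝ) (q : I → ℝ)
    (hp : ∀ j, 0 ≤ p j) (hq : ∀ i, 0 ≤ q i) (t : ℝ) (ht : 0 < t) :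
    HasDerivAt (fun t => ∑ i, ∑ j, w i j * (p j * Real.log (q i + t * p j)))
      (∑ i, ∑ j, w i j * (p j ^ 2 / (q i + t * p j))) t := by
  refine HasDerivAt.fun_sum fun i _ => HasDerivAt.fun_sum fun j _ => ?_
  refine HasDerivAt.const_mul _ ?_
  rcases (hp j).eq_or_lt with h | h
  · simp [← h, hasDerivAt_const]
  · have hpos : 0 < q i + t * p j := by have := hq i; positivity
    have h1 : HasDerivAt (fun t => q i + t * p j) (p j) t := by
      simpa using ((hasDerivAt_id t).mul_const (p j)).const_add (q i)
    have := (h1.log hpos.ne').const_mul (p j)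
    convert this using 1
    ring

open Filter Topology in
lemma lim_zero_real {I J : Type} [Fintype I] [Fintype J] (w : I → J → ℝ) (p : J → ℝ) (q : I → ℝ)
    (hs : ∀ i, q i = 0 → ∀ j, w i j * p j = 0) :
    Tendsto (fun t => ∑ i, ∑ j, w i j * (p j * Real.log (q i + t * p j))) (𝓝[>] (0:ℝ))
      (𝓝 (∑ i, ∑ j, w i j * (p j * Real.log (q i)))) := by
  refine tendsto_finsetSum _ fun i _ => tendsto_finsetSum _ fun j _ => ?_
  by_cases h : q i = 0
  · have := hs i h j
    simp only [← mul_assoc, this, zero_mul]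
    exact tendsto_const_nhds
  · refine Tendsto.const_mul _ (Tendsto.const_mul _ ?_)
    have h2 : Tendsto (fun t : ℝ => q i + t * p j) (𝓝 0) (𝓝 (q i)) := by
      have : Continuous (fun t : ℝ => q i + t * p j) := by fun_prop
      simpa using this.tendsto 0
    exact (h2.mono_left nhdsWithin_le_nhds).log h

open Filter Topology in
lemma lim_top_real {I J : Type} [Fintype I] [Fintype J] (w : I → J → ℝ) (p : J → ℝ) (q : I → ℝ)
    (hp : ∀ j, 0 ≤ p j) (hq : ∀ i, 0 ≤ q i) (hw : ∀ j, ∑ i, w i j = 1) :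
    Tendsto (fun t => (∑ i, ∑ j, w i j * (p j * Real.log (q i + t * p j)))
       - (∑ j, p j) * Real.log t) atTop
      (𝓝 (∑ j, p j * Real.log (p j))) := by
  have key : ∑ j, p j * Real.log (p j) = ∑ i, ∑ j, w i j * (p j * Real.log (p j)) := by
    rw [Finset.sum_comm]
    refine Finset.sum_congr rfl fun j _ => ?_
    rw [← Finset.sum_mul, hw, one_mul]
  have key2 : ∑ j, p j = ∑ i, ∑ j, w i j * p j := by
    rw [Finset.sum_comm]
    refine Finset.sum_congr rfl fun j _ => ?_
    rw [← Finset.sum_mul, hw, one_mul]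
  have h1 : Tendsto (fun t => ∑ i, ∑ j, w i j * (p j * Real.log (q i * t⁻¹ + p j))) atTop
      (𝓝 (∑ j, p j * Real.log (p j))) := by
    rw [key]
    refine tendsto_finsetSum _ fun i _ => tendsto_finsetSum _ fun j _ => ?_
    refine Tendsto.const_mul _ ?_
    by_cases h : p j = 0
    · simp [h]
    · refine Tendsto.const_mul _ (Tendsto.log ?_ h)
      have : Tendsto (fun t : ℝ => t⁻¹) atTop (𝓝 0) := tendsto_inv_atTop_zero
      simpa using (this.const_mul (q i)).add_const (p j)
  refine h1.congr' ?_
  filter_upwards [eventually_gt_atTop 0] with t ht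
  rw [key2, Finset.sum_mul, ← Finset.sum_sub_distrib]
  refine Finset.sum_congr rfl fun i _ => ?_
  rw [Finset.sum_mul, ← Finset.sum_sub_distrib]
  refine Finset.sum_congr rfl fun j _ => ?_
  rcases (hp j).eq_or_lt with h | h
  · simp [← h]
  · have hpos : 0 < q i + t * p j := by have := hq i; positivity
    have : q i * t⁻¹ + p j = (q i + t * p j) / t := by field_simp
    rw [this, Real.log_div hpos.ne' ht.ne']
    ring

open Filter Topology in
lemma relent_real {I J I' J' : Type} [Fintype I] [Fintype J] [Fintype I'] [Fintype J']
    (w : I → J → ℝ) (p : J → ℝ) (q : I → ℝ)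
    (hp : ∀ j, 0 ≤ p j) (hq : ∀ i, 0 ≤ q i) (hw : ∀ j, ∑ i, w i j = 1)
    (hs : ∀ i, q i = 0 → ∀ j, w i j * p j = 0)
    (w' : I' → J' → ℝ) (p' : J' → ℝ) (q' : I' → ℝ)
    (hp' : ∀ j, 0 ≤ p' j) (hq' : ∀ i, 0 ≤ q' i) (hw' : ∀ j, ∑ i, w' i j = 1)
    (hs' : ∀ i, q' i = 0 → ∀ j, w' i j * p' j = 0)
    (htr : ∑ j, p j = ∑ j, p' j)
    (hG : ∀ t > 0, ∑ i, ∑ j, w' i j * (p' j ^ 2 / (q' i + t * p' j)) ≤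
      ∑ i, ∑ j, w i j * (p j ^ 2 / (q i + t * p j))) :
    (∑ i, ∑ j, w i j * (p j * Real.log (q i))) - (∑ i, ∑ j, w' i j * (p' j * Real.log (q' i)))
     ≤ (∑ j, p j * Real.log (p j)) - (∑ j, p' j * Real.log (p' j)) := by
  set D : ℝ → ℝ := fun t => (∑ i, ∑ j, w i j * (p j * Real.log (q i + t * p j))) -
    (∑ i, ∑ j, w' i j * (p' j * Real.log (q' i + t * p' j))) with hD
  have hder : ∀ t > 0, HasDerivAt D (∑ i, ∑ j, w i j * (p j ^ 2 / (q i + t * p j)) -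
      ∑ i, ∑ j, w' i j * (p' j ^ 2 / (q' i + t * p' j))) t := fun t ht =>
    (G_mono_real w p q hp hq t ht).sub (G_mono_real w' p' q' hp' hq' t ht)
  have hmono : MonotoneOn D (Set.Ioi 0) := by
    refine monotoneOn_of_deriv_nonneg (convex_Ioi 0) ?_ ?_ ?_
    · exact fun t ht => (hder t ht).continuousAt.continuousWithinAt
    · rw [interior_Ioi]
      exact fun t ht => (hder t ht).differentiableAt.differentiableWithinAt
    · rw [interior_Ioi]
      intro t ht
      rw [(hder t ht).deriv]
      linarith [hG t ht]
  have l0 := (lim_zero_real w p q hs).sub (lim_zero_real w' p' q' hs')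
  have l1 := (lim_top_real w p q hp hq hw).sub (lim_top_real w' p' q' hp' hq' hw')
  have a0 := le_of_tendsto (b := D 1) l0 (by
    filter_upwards [Ioo_mem_nhdsGT (zero_lt_one' ℝ)] with t ht
    exact hmono ht.1 (Set.mem_Ioi.2 one_pos) ht.2.le)
  have a1 := ge_of_tendsto (b := D 1) l1 (by
    filter_upwards [eventually_ge_atTop 1] with t ht
    have := hmono (Set.mem_Ioi.2 one_pos) (Set.mem_Ioi.2 (lt_of_lt_of_le one_pos ht)) ht
    rw [htr]
    simp only [hD] at this ⊢
    linarith)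
  exact a0.trans a1

/-- variational functional -/
noncomputable def vfun {n : Type} [Fintype n] (t : ℝ) (ρ σ X : Matrix n n ℂ) : ℝ :=
  2 * (trace (Xᴴ * ρ)).re - (trace (Xᴴ * σ * X)).re - t * (trace (X * ρ * Xᴴ)).re

lemma vfun_eq {n I J : Type} [Fintype n] [Fintype I] [Fintype J] [DecidableEq n] [DecidableEq I]
    [DecidableEq J] (t : ℝ) (V : Matrix n J ℂ) (U : Matrix n I ℂ) (p : J → ℝ) (q : I → ℝ)
    (hV : Vᴴ * V = 1) (hU : Uᴴ * U = 1) (Y : Matrix I J ℂ) :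
    vfun t (V * diagonal (fun j => (p j : ℂ)) * Vᴴ) (U * diagonal (fun j => (q j : ℂ)) * Uᴴ)
      (U * Y * Vᴴ) = ∑ i, ∑ j, (2 * (star (Y i j) * (Uᴴ * V) i j).re * p j
        - (q i + t * p j) * Complex.normSq (Y i j)) := by
  have e1 : trace ((U * Y * Vᴴ)ᴴ * (V * diagonal (fun j => (p j : ℂ)) * Vᴴ)) =
      trace (Yᴴ * ((Uᴴ * V) * diagonal (fun j => (p j : ℂ)))) := by
    have : (U * Y * Vᴴ)ᴴ * (V * diagonal (fun j => (p j : ℂ)) * Vᴴ) =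
      V * (Yᴴ * ((Uᴴ * V) * diagonal (fun j => (p j : ℂ))) * Vᴴ) := by
      simp only [conjTranspose_mul, conjTranspose_conjTranspose, Matrix.mul_assoc]
    rw [this, trace_mul_comm, Matrix.mul_assoc, hV, Matrix.mul_one]
  have e2 : trace ((U * Y * Vᴴ)ᴴ * (U * diagonal (fun j => (q j : ℂ)) * Uᴴ) * (U * Y * Vᴴ)) =
      trace (Yᴴ * (diagonal (fun j => (q j : ℂ)) * Y)) := by
    have : (U * Y * Vᴴ)ᴴ * (U * diagonal (fun j => (q j : ℂ)) * Uᴴ) * (U * Y * Vᴴ) =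
      V * (Yᴴ * ((Uᴴ * U) * diagonal (fun j => (q j : ℂ)) * (Uᴴ * U) * Y) * Vᴴ) := by
      simp only [conjTranspose_mul, conjTranspose_conjTranspose, Matrix.mul_assoc]
    rw [this, trace_mul_comm, Matrix.mul_assoc, hV, Matrix.mul_one, hU, Matrix.mul_one,
      Matrix.one_mul]
  have e3 : trace ((U * Y * Vᴴ) * (V * diagonal (fun j => (p j : ℂ)) * Vᴴ) * (U * Y * Vᴴ)ᴴ) =
      trace (Y * (diagonal (fun j => (p j : ℂ)) * Yᴴ)) := by
    have : (U * Y * Vᴴ) * (V * diagonal (fun j => (p j : ℂ)) * Vᴴ) * (U * Y * Vᴴ)ᴴ =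
      U * (Y * ((Vᴴ * V) * diagonal (fun j => (p j : ℂ)) * (Vᴴ * V) * Yᴴ) * Uᴴ) := by
      simp only [conjTranspose_mul, conjTranspose_conjTranspose, Matrix.mul_assoc]
    rw [this, trace_mul_comm, Matrix.mul_assoc, hU, Matrix.mul_one, hV, Matrix.mul_one,
      Matrix.one_mul]
  unfold vfun
  rw [e1, e2, e3]
  set C := Uᴴ * V
  have f1 : (trace (Yᴴ * (C * diagonal (fun j => (p j : ℂ))))).re =
      ∑ i, ∑ j, (star (Y i j) * C i j).re * p j := by
    rw [trace, Finset.sum_comm]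
    simp only [diag_apply, mul_apply (M := Yᴴ), mul_diagonal, conjTranspose_apply, Complex.re_sum]
    refine Finset.sum_congr rfl fun i _ => Finset.sum_congr rfl fun j _ => ?_
    rw [← mul_assoc, Complex.re_mul_ofReal]
  have f2 : (trace (Yᴴ * (diagonal (fun j => (q j : ℂ)) * Y))).re =
      ∑ i, ∑ j, q i * Complex.normSq (Y i j) := by
    rw [trace, Finset.sum_comm]
    simp only [diag_apply, mul_apply (M := Yᴴ), diagonal_mul, conjTranspose_apply, Complex.re_sum]
    refine Finset.sum_congr rfl fun i _ => Finset.sum_congr rfl fun j _ => ?_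
    rw [Complex.normSq_apply]
    simp
    ring
  have f3 : (trace (Y * (diagonal (fun j => (p j : ℂ)) * Yᴴ))).re =
      ∑ i, ∑ j, p j * Complex.normSq (Y i j) := by
    rw [trace]
    simp only [diag_apply, mul_apply (M := Y), diagonal_mul, conjTranspose_apply, Complex.re_sum]
    refine Finset.sum_congr rfl fun i _ => Finset.sum_congr rfl fun j _ => ?_
    rw [Complex.normSq_apply]
    simp
    ring
  rw [f1, f2, f3]
  simp only [Finset.mul_sum, ← Finset.sum_sub_distrib]
  refine Finset.sum_congr rfl fun i _ => Finset.sum_congr rfl fun j _ => ?_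
  ring

lemma scal_le (y c : ℂ) (p q t : ℝ) (hp : 0 ≤ p) (hq : 0 ≤ q) (ht : 0 < t) :
    2 * (star y * c).re * p - (q + t * p) * Complex.normSq y ≤
      Complex.normSq c * (p ^ 2 / (q + t * p)) := by
  rcases hp.eq_or_lt with h | h
  · subst h
    have := mul_nonneg hq (Complex.normSq_nonneg y)
    simp
    linarith
  · have hpos : 0 < q + t * p := by positivity
    rw [← mul_div_assoc, le_div_iff₀ hpos]
    simp only [Complex.normSq_apply, Complex.mul_re, Complex.star_def, Complex.conj_re,
      Complex.conj_im]
    set s := q + t * p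
    nlinarith [sq_nonneg (s * y.re - p * c.re), sq_nonneg (s * y.im - p * c.im)]

lemma scal_eq (c : ℂ) (p q t : ℝ) (hp : 0 ≤ p) (hq : 0 ≤ q) (ht : 0 < t) :
    2 * (star (c * ((p / (q + t * p) : ℝ) : ℂ)) * c).re * p -
      (q + t * p) * Complex.normSq (c * ((p / (q + t * p) : ℝ) : ℂ)) =
      Complex.normSq c * (p ^ 2 / (q + t * p)) := by
  rcases hp.eq_or_lt with h | h
  · subst h
    simp
  · have hpos : 0 < q + t * p := by positivity
    simp only [Complex.normSq_apply, Complex.mul_re, Complex.mul_im, Complex.star_def, Complex.conj_re,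
      Complex.conj_im, Complex.ofReal_re, Complex.ofReal_im]
    set s := q + t * p
    field_simp
    ring

lemma vfun_le {n I J : Type} [Fintype n] [Fintype I] [Fintype J] [DecidableEq n] [DecidableEq I]
    [DecidableEq J] (t : ℝ) (ht : 0 < t) (V : Matrix n J ℂ) (U : Matrix n I ℂ) (p : J → ℝ)
    (q : I → ℝ) (hp : ∀ j, 0 ≤ p j) (hq : ∀ i, 0 ≤ q i)
    (hV : Vᴴ * V = 1) (hU : Uᴴ * U = 1) (hV' : V * Vᴴ = 1) (hU' : U * Uᴴ = 1) (X : Matrix n n ℂ) :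
    vfun t (V * diagonal (fun j => (p j : ℂ)) * Vᴴ) (U * diagonal (fun j => (q j : ℂ)) * Uᴴ)
      X ≤ ∑ i, ∑ j, Complex.normSq ((Uᴴ * V) i j) * (p j ^ 2 / (q i + t * p j)) := by
  have : X = U * (Uᴴ * X * V) * Vᴴ := by
    calc X = (U * Uᴴ) * X * (V * Vᴴ) := by rw [hV', hU']; simp
      _ = _ := by simp only [Matrix.mul_assoc]
  rw [this, vfun_eq t V U p q hV hU]
  exact Finset.sum_le_sum fun i _ => Finset.sum_le_sum fun j _ =>
    scal_le _ _ _ _ _ (hp j) (hq i) ht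

lemma vfun_attain {n I J : Type} [Fintype n] [Fintype I] [Fintype J] [DecidableEq n] [DecidableEq I]
    [DecidableEq J] (t : ℝ) (ht : 0 < t) (V : Matrix n J ℂ) (U : Matrix n I ℂ) (p : J → ℝ)
    (q : I → ℝ) (hp : ∀ j, 0 ≤ p j) (hq : ∀ i, 0 ≤ q i)
    (hV : Vᴴ * V = 1) (hU : Uᴴ * U = 1) :
    ∃ X, vfun t (V * diagonal (fun j => (p j : ℂ)) * Vᴴ) (U * diagonal (fun j => (q j : ℂ)) * Uᴴ)
      X = ∑ i, ∑ j, Complex.normSq ((Uᴴ * V) i j) * (p j ^ 2 / (q i + t * p j)) := by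
  refine ⟨U * (Matrix.of fun i j => (Uᴴ * V) i j * ((p j / (q i + t * p j) : ℝ) : ℂ)) * Vᴴ, ?_⟩
  rw [vfun_eq t V U p q hV hU]
  exact Finset.sum_congr rfl fun i _ => Finset.sum_congr rfl fun j _ =>
    scal_eq _ _ _ _ (hp j) (hq i) ht

lemma trace_kron_one {n m : Type} [Fintype n] [Fintype m] [DecidableEq m]
    (Z : Matrix n n ℂ) (ρ : Matrix (n × m) (n × m) ℂ) :
    trace ((Z ⊗ₖ (1 : Matrix m m ℂ)) * ρ) = trace (Z * ptSnd ρ) := by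
  simp only [trace, diag_apply, mul_apply, Fintype.sum_prod_type, kroneckerMap_apply, ptSnd,
    Matrix.of_apply, Matrix.one_apply, mul_ite, mul_one, mul_zero, ite_mul, zero_mul,
    Finset.sum_ite_eq, Finset.mem_univ, if_true, Finset.mul_sum]
  refine Finset.sum_congr rfl fun i _ => ?_
  rw [Finset.sum_comm]

lemma vfun_kron {n m : Type} [Fintype n] [Fintype m] [DecidableEq m] (t : ℝ)
    (ρ σ : Matrix (n × m) (n × m) ℂ) (X : Matrix n n ℂ) :
    vfun t ρ σ (X ⊗ₖ (1 : Matrix m m ℂ)) = vfun t (ptSnd ρ) (ptSnd σ) X := by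
  unfold vfun
  have h : (X ⊗ₖ (1 : Matrix m m ℂ))ᴴ = Xᴴ ⊗ₖ (1 : Matrix m m ℂ) := by
    rw [conjTranspose_kronecker, conjTranspose_one]
  rw [h, trace_kron_one, trace_mul_cycle, ← mul_kronecker_mul, trace_mul_cycle _ ρ,
    ← mul_kronecker_mul, Matrix.mul_one, trace_kron_one, trace_kron_one,
    trace_mul_cycle Xᴴ (ptSnd σ),
    trace_mul_cycle X (ptSnd ρ)]

lemma vnH_roots {n : Type} [Fintype n] [DecidableEq n] (ρ : Matrix n n ℂ) (h : ρ.IsHermitian) :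
    vnH ρ = -(ρ.charpoly.roots.map (fun z => z.re * Real.logb 2 z.re)).sum := by
  rw [vnH, dif_pos h, h.roots_charpoly_eq_eigenvalues, Multiset.map_map]
  simp only [Function.comp_def]
  rfl

lemma vnH_mul_comm {m n : Type} [Fintype m] [DecidableEq m] [Fintype n] [DecidableEq n]
    (A : Matrix m n ℂ) (B : Matrix n m ℂ) (h1 : (A * B).IsHermitian) (h2 : (B * A).IsHermitian) :
    vnH (A * B) = vnH (B * A) := by
  rw [vnH_roots _ h1, vnH_roots _ h2]
  have h := congrArg (fun q => (q.roots.map (fun z : ℂ => z.re * Real.logb 2 z.re)).sum)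
    (charpoly_mul_comm' A B)
  have ne1 := (charpoly_monic (A * B)).ne_zero
  have ne2 := (charpoly_monic (B * A)).ne_zero
  rw [Polynomial.roots_mul (mul_ne_zero (pow_ne_zero _ Polynomial.X_ne_zero) ne1),
    Polynomial.roots_mul (mul_ne_zero (pow_ne_zero _ Polynomial.X_ne_zero) ne2)] at h
  simp [Multiset.map_nsmul, Multiset.sum_nsmul] at h
  rw [h]

lemma vnH_submatrix {m n : Type} [Fintype m] [DecidableEq m] [Fintype n] [DecidableEq n]
    (A : Matrix m m ℂ) (h : A.IsHermitian) (e : n ≃ m) : vnH (A.submatrix e e) = vnH A := by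
  rw [vnH_roots _ h, vnH_roots _ (h.submatrix e)]
  have : A.submatrix e e = reindex e.symm e.symm A := rfl
  rw [this, charpoly_reindex]

/-- entropy of the `K` marginal of a bipartite vector -/
noncomputable def Hm {K T : Type} [Fintype K] [DecidableEq K] [Fintype T] (Φ : K → T → ℂ) : ℝ :=
  vnH (Matrix.of Φ * (Matrix.of Φ)ᴴ)

lemma Hm_congr {K T K' T' : Type} [Fintype K] [DecidableEq K] [Fintype T]
    [Fintype K'] [DecidableEq K'] [Fintype T'] (Φ : K → T → ℂ) (Φ' : K' → T' → ℂ)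
    (eK : K ≃ K') (eT : T ≃ T') (h : ∀ k t, Φ k t = Φ' (eK k) (eT t)) : Hm Φ = Hm Φ' := by
  unfold Hm
  rw [← vnH_submatrix _ (isHermitian_mul_conjTranspose_self _) eK]
  congr 1
  ext i j
  simp only [mul_apply, submatrix_apply, conjTranspose_apply, Matrix.of_apply, h]
  exact eT.sum_comp (fun t => Φ' (eK i) t * star (Φ' (eK j) t))

lemma Hm_iso {K E F T : Type} [Fintype K] [DecidableEq K] [Fintype T] [DecidableEq T]
    [Fintype E] [DecidableEq E] [Fintype F] [DecidableEq F] (Φ : K × E → T → ℂ) (Φ' : K × F → T → ℂ)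
    (W : E → F → ℂ) (h1 : ∀ k f t, Φ' (k, f) t = ∑ e, W e f * Φ (k, e) t)
    (h2 : ∀ k e t, Φ (k, e) t = ∑ f, star (W e f) * Φ' (k, f) t) : Hm Φ' = Hm Φ := by
  unfold Hm
  rw [vnH_mul_comm _ _ (isHermitian_mul_conjTranspose_self _)
    (isHermitian_conjTranspose_mul_self _), vnH_mul_comm (Matrix.of Φ) _
    (isHermitian_mul_conjTranspose_self _) (isHermitian_conjTranspose_mul_self _)]
  congr 1
  ext s t
  simp only [mul_apply, conjTranspose_apply, Matrix.of_apply, Fintype.sum_prod_type]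
  refine Finset.sum_congr rfl fun k _ => ?_
  calc ∑ f, star (Φ' (k, f) s) * Φ' (k, f) t
      = ∑ f, ∑ e, star (Φ' (k, f) s) * (W e f * Φ (k, e) t) := by
        refine Finset.sum_congr rfl fun f _ => ?_
        rw [h1 k f t, Finset.mul_sum]
    _ = ∑ e, ∑ f, star (Φ' (k, f) s) * (W e f * Φ (k, e) t) := Finset.sum_comm
    _ = _ := by
        refine Finset.sum_congr rfl fun e _ => ?_
        rw [h2 k e s, star_sum, Finset.sum_mul]
        refine Finset.sum_congr rfl fun f _ => ?_
        rw [star_mul', star_star]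
        ring

open scoped ComplexOrder in
lemma diag_exists {n : Type} [Fintype n] [DecidableEq n] (A : Matrix n n ℂ) (hA : A.PosSemidef) :
    ∃ (V : Matrix n n ℂ) (p : n → ℝ), Vᴴ * V = 1 ∧ V * Vᴴ = 1 ∧ (∀ j, 0 ≤ p j) ∧
      A = V * diagonal (fun j => (p j : ℂ)) * Vᴴ ∧
      vnH A = -(∑ j, p j * Real.log (p j)) / Real.log 2 := by
  have h := hA.isHermitian
  refine ⟨h.eigenvectorUnitary, h.eigenvalues, ?_, ?_, hA.eigenvalues_nonneg, ?_, ?_⟩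
  · exact Unitary.coe_star_mul_self _
  · exact Unitary.coe_mul_star_self _
  · conv_lhs => rw [h.spectral_theorem, Unitary.conjStarAlgAut_apply]
    rfl
  · rw [vnH, dif_pos h, neg_div, Finset.sum_div]
    simp only [Real.logb, mul_div_assoc]

lemma normSq_sum_eq {N I J : Type} [Fintype N] [Fintype I] [Fintype J] [DecidableEq J]
    (U : Matrix N I ℂ) (V : Matrix N J ℂ) (p : J → ℝ) (i : I) :
    ((∑ j, Complex.normSq ((Uᴴ * V) i j) * p j : ℝ) : ℂ) =
      (Uᴴ * (V * diagonal (fun j => (p j : ℂ)) * Vᴴ) * U) i i := by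
  have : Uᴴ * (V * diagonal (fun j => (p j : ℂ)) * Vᴴ) * U =
    (Uᴴ * V) * diagonal (fun j => (p j : ℂ)) * (Uᴴ * V)ᴴ := by
    simp only [conjTranspose_mul, conjTranspose_conjTranspose, Matrix.mul_assoc]
  rw [this, mul_apply]
  push_cast
  refine Finset.sum_congr rfl fun j _ => ?_
  rw [mul_diagonal, conjTranspose_apply, Complex.normSq_eq_conj_mul_self, Complex.star_def]
  ring

lemma col_sum {N I J : Type} [Fintype N] [Fintype I] [Fintype J] [DecidableEq J] [DecidableEq N]
    (U : Matrix N I ℂ) (V : Matrix N J ℂ) (hU : U * Uᴴ = 1) (hV : Vᴴ * V = 1) (j : J) :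
    ∑ i, Complex.normSq ((Uᴴ * V) i j) = 1 := by
  have : ((Uᴴ * V)ᴴ * (Uᴴ * V)) = 1 := by
    calc _ = Vᴴ * (U * Uᴴ) * V := by
          simp only [conjTranspose_mul, conjTranspose_conjTranspose, Matrix.mul_assoc]
      _ = 1 := by rw [hU, Matrix.mul_one, hV]
  have h := congrFun (congrFun this j) j
  rw [mul_apply, one_apply_eq] at h
  have h2 : ((∑ i, Complex.normSq ((Uᴴ * V) i j) : ℝ) : ℂ) = 1 := by
    rw [← h]
    push_cast
    refine Finset.sum_congr rfl fun i _ => ?_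
    rw [Complex.normSq_eq_conj_mul_self, conjTranspose_apply, Complex.star_def]
  exact_mod_cast h2

/-- `1 ⊗ U`, rows reindexed. -/
noncomputable def liftU {N α κ : Type} [DecidableEq α] (e : N ≃ α × κ) (U : Matrix κ κ ℂ) :
    Matrix N (α × κ) ℂ := Matrix.of fun x y => if (e x).1 = y.1 then U (e x).2 y.2 else 0

lemma liftU_left {N α κ : Type} [Fintype N] [Fintype α] [Fintype κ] [DecidableEq α] [DecidableEq κ]
    (e : N ≃ α × κ) (U : Matrix κ κ ℂ) (h : Uᴴ * U = 1) : (liftU e U)ᴴ * liftU e U = 1 := by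
  ext ⟨a, k⟩ ⟨b, l⟩
  have h' := congrFun (congrFun h k) l
  rw [mul_apply] at h'
  rw [mul_apply, ← e.symm.sum_comp, Fintype.sum_prod_type]
  simp only [liftU, conjTranspose_apply, Matrix.of_apply, Equiv.apply_symm_apply, apply_ite star,
    star_zero, ite_mul, zero_mul, mul_ite, mul_zero]
  by_cases hab : a = b
  · subst hab
    simp only [conjTranspose_apply] at h'
    simp [one_apply] at h' ⊢
    exact h'
  · have : (1 : Matrix (α × κ) (α × κ) ℂ) (a, k) (b, l) = 0 := by
      rw [one_apply_ne]; simp [hab]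
    rw [this]
    refine Finset.sum_eq_zero fun x _ => Finset.sum_eq_zero fun y _ => ?_
    split_ifs with h1 h2
    · exact absurd (h2.symm.trans h1) hab
    · rfl
    · rfl

lemma liftU_conj {N α κ : Type} [Fintype α] [Fintype κ] [DecidableEq α] [DecidableEq κ]
    (e : N ≃ α × κ) (U : Matrix κ κ ℂ) (d : κ → ℂ) (x y : N) :
    (liftU e U * diagonal (fun i : α × κ => d i.2) * (liftU e U)ᴴ) x y =
      if (e x).1 = (e y).1 then (U * diagonal d * Uᴴ) (e x).2 (e y).2 else 0 := by
  rw [mul_apply]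
  simp only [mul_diagonal, Fintype.sum_prod_type, liftU,
    conjTranspose_apply, Matrix.of_apply, apply_ite star, star_zero, mul_ite, mul_zero,
    ite_mul, zero_mul]
  rw [Finset.sum_comm]
  simp only [Finset.sum_ite_eq, Finset.mem_univ, if_true]
  split_ifs with h
  · rw [mul_apply]
    refine Finset.sum_congr rfl fun k _ => ?_
    rw [mul_diagonal]
    rfl
  · refine Finset.sum_eq_zero fun k _ => ?_
    simp [h, Ne.symm h]

lemma liftU_right {N α κ : Type} [Fintype α] [Fintype κ] [DecidableEq α] [DecidableEq κ]
    [DecidableEq N]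
    (e : N ≃ α × κ) (U : Matrix κ κ ℂ) (h : U * Uᴴ = 1) : liftU e U * (liftU e U)ᴴ = 1 := by
  ext x y
  have := liftU_conj e U (fun _ => 1) x y
  simp only [diagonal_one, Matrix.mul_one, h] at this
  rw [this, one_apply, one_apply]
  simp only [← ite_and, ← Prod.ext_iff, e.apply_eq_iff_eq]

lemma lift_sum {N α κ J : Type} [Fintype N] [Fintype α] [Fintype κ] [DecidableEq α] [DecidableEq κ]
    [Fintype J] [DecidableEq J] (e : N ≃ α × κ) (U : Matrix κ κ ℂ) (V : Matrix N J ℂ) (p : J → ℝ)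
    (q : κ → ℝ) (hU : Uᴴ * U = 1)
    (hτ : ∀ k l, ∑ a, (V * diagonal (fun j => (p j : ℂ)) * Vᴴ) (e.symm (a, k)) (e.symm (a, l)) =
      (U * diagonal (fun j => (q j : ℂ)) * Uᴴ) k l) (k : κ) :
    ∑ a, ∑ j, Complex.normSq (((liftU e U)ᴴ * V) (a, k) j) * p j = q k := by
  have h1 : ((∑ a, ∑ j, Complex.normSq (((liftU e U)ᴴ * V) (a, k) j) * p j : ℝ) : ℂ) = q k := by
    rw [Complex.ofReal_sum]
    simp only [normSq_sum_eq]
    generalize (V * diagonal (fun j => (p j : ℂ)) * Vᴴ) = ρ at hτ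
    have h2 : (Uᴴ * (U * diagonal (fun j => (q j : ℂ)) * Uᴴ) * U) k k = q k := by
      have : Uᴴ * (U * diagonal (fun j => (q j : ℂ)) * Uᴴ) * U =
        (Uᴴ * U) * diagonal (fun j => (q j : ℂ)) * (Uᴴ * U) := by
        simp only [Matrix.mul_assoc]
      rw [this, hU]; simp
    rw [← h2]
    generalize (U * diagonal (fun j => (q j : ℂ)) * Uᴴ) = τ at hτ
    have h3 : ∀ a, ((liftU e U)ᴴ * ρ * liftU e U) (a, k) (a, k) =
        ∑ l, ∑ m, star (U m k) * ρ (e.symm (a, m)) (e.symm (a, l)) * U l k := by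
      intro a
      rw [mul_apply, ← e.symm.sum_comp, Fintype.sum_prod_type]
      simp only [mul_apply]
      simp only [← e.symm.sum_comp (fun x => (liftU e U)ᴴ _ x * ρ x _), Fintype.sum_prod_type]
      simp only [liftU, conjTranspose_apply, Matrix.of_apply, Equiv.apply_symm_apply,
        apply_ite star, star_zero, ite_mul, zero_mul, mul_ite, mul_zero]
      rw [Finset.sum_comm]
      simp only [Finset.sum_ite_eq', Finset.mem_univ, if_true]
      refine Finset.sum_congr rfl fun l _ => ?_
      rw [Finset.sum_comm]
      simp only [Finset.sum_ite_eq', Finset.mem_univ, if_true, Finset.sum_mul]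
    simp only [h3]
    rw [Finset.sum_comm, mul_apply]
    refine Finset.sum_congr rfl fun l _ => ?_
    rw [Finset.sum_comm, mul_apply, Finset.sum_mul]
    refine Finset.sum_congr rfl fun m _ => ?_
    rw [← hτ, conjTranspose_apply, Finset.mul_sum, Finset.sum_mul]
  exact_mod_cast h1

lemma lift_supp {N α κ J : Type} [Fintype N] [Fintype α] [Fintype κ] [DecidableEq α] [DecidableEq κ]
    [Fintype J] [DecidableEq J] (e : N ≃ α × κ) (U : Matrix κ κ ℂ) (V : Matrix N J ℂ) (p : J → ℝ)
    (hp : ∀ j, 0 ≤ p j)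
    (q : κ → ℝ) (hU : Uᴴ * U = 1)
    (hτ : ∀ k l, ∑ a, (V * diagonal (fun j => (p j : ℂ)) * Vᴴ) (e.symm (a, k)) (e.symm (a, l)) =
      (U * diagonal (fun j => (q j : ℂ)) * Uᴴ) k l) (i : α × κ) (hi : q i.2 = 0) (j : J) :
    Complex.normSq (((liftU e U)ᴴ * V) i j) * p j = 0 := by
  have h := lift_sum e U V p q hU hτ i.2
  rw [hi] at h
  have hn : ∀ a j, 0 ≤ Complex.normSq (((liftU e U)ᴴ * V) (a, i.2) j) * p j := fun a j =>
    mul_nonneg (Complex.normSq_nonneg _) (hp j)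
  rw [Finset.sum_eq_zero_iff_of_nonneg (fun a _ => Finset.sum_nonneg fun j _ => hn a j)] at h
  have h2 := h i.1 (Finset.mem_univ _)
  rw [Finset.sum_eq_zero_iff_of_nonneg (fun j _ => hn _ j)] at h2
  exact h2 j (Finset.mem_univ _)

lemma lift_log {N α κ J : Type} [Fintype N] [Fintype α] [Fintype κ] [DecidableEq α] [DecidableEq κ]
    [Fintype J] [DecidableEq J] (e : N ≃ α × κ) (U : Matrix κ κ ℂ) (V : Matrix N J ℂ) (p : J → ℝ)
    (q : κ → ℝ) (hU : Uᴴ * U = 1)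
    (hτ : ∀ k l, ∑ a, (V * diagonal (fun j => (p j : ℂ)) * Vᴴ) (e.symm (a, k)) (e.symm (a, l)) =
      (U * diagonal (fun j => (q j : ℂ)) * Uᴴ) k l) :
    ∑ i, ∑ j, Complex.normSq (((liftU e U)ᴴ * V) i j) * (p j * Real.log (q i.2)) =
      ∑ k, q k * Real.log (q k) := by
  rw [Fintype.sum_prod_type, Finset.sum_comm]
  refine Finset.sum_congr rfl fun k _ => ?_
  simp only [← mul_assoc]
  simp only [← Finset.sum_mul]
  rw [lift_sum e U V p q hU hτ]

open scoped ComplexOrder in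
theorem SSA {α β γ δ : Type} [Fintype α] [DecidableEq α] [Fintype β] [DecidableEq β]
    [Fintype γ] [DecidableEq γ] [Fintype δ] (Φ : α → β → γ → δ → ℂ) :
    Hm (fun (x : (α × γ) × β) (d : δ) => Φ x.1.1 x.2 x.1.2 d) +
      Hm (fun (c : γ) (y : β × α × δ) => Φ y.2.1 y.1 c y.2.2) ≤
    Hm (fun (x : α × γ) (y : β × δ) => Φ x.1 y.1 x.2 y.2) +
      Hm (fun (x : γ × β) (y : α × δ) => Φ y.1 x.2 x.1 y.2) := by
  unfold Hm
  set M1 := (Matrix.of fun (x : (α × γ) × β) (d : δ) => Φ x.1.1 x.2 x.1.2 d)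
  set M2 := (Matrix.of fun (c : γ) (y : β × α × δ) => Φ y.2.1 y.1 c y.2.2)
  set M3 := (Matrix.of fun (x : α × γ) (y : β × δ) => Φ x.1 y.1 x.2 y.2)
  set M4 := (Matrix.of fun (x : γ × β) (y : α × δ) => Φ y.1 x.2 x.1 y.2)
  have r1 : ptSnd (M1 * M1ᴴ) = M3 * M3ᴴ := by
    ext x y
    simp [ptSnd, mul_apply, M1, M3, Fintype.sum_prod_type]
  have r2 : ∀ k l, ∑ a, (M1 * M1ᴴ) ((Equiv.prodAssoc α γ β).symm (a, k))
      ((Equiv.prodAssoc α γ β).symm (a, l)) = (M4 * M4ᴴ) k l := by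
    intro k l
    simp [mul_apply, M1, M4, Fintype.sum_prod_type]
  have r3 : ptSnd (M4 * M4ᴴ) = M2 * M2ᴴ := by
    ext x y
    simp [ptSnd, mul_apply, M2, M4, Fintype.sum_prod_type]
  have r4 : ∀ k l, ∑ a, (M3 * M3ᴴ) ((Equiv.refl (α × γ)).symm (a, k))
      ((Equiv.refl (α × γ)).symm (a, l)) = (M2 * M2ᴴ) k l := by
    intro k l
    simp only [mul_apply, M2, M3, Fintype.sum_prod_type, conjTranspose_apply, Matrix.of_apply,
      Equiv.refl_symm, Equiv.refl_apply]
    rw [Finset.sum_comm]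
  obtain ⟨V, p, hV, hV', hp, hρ, hH1⟩ := diag_exists _ (posSemidef_self_mul_conjTranspose M1)
  obtain ⟨U0', q', hU0', hUU0', hq', hτ', hH2⟩ := diag_exists _ (posSemidef_self_mul_conjTranspose M2)
  obtain ⟨V', p', hV1, hVV1, hp', hρ', hH3⟩ := diag_exists _ (posSemidef_self_mul_conjTranspose M3)
  obtain ⟨U0, q, hU0, hUU0, hq, hτ, hH4⟩ := diag_exists _ (posSemidef_self_mul_conjTranspose M4)
  rw [hH1, hH2, hH3, hH4]
  have r2' := r2
  have r4' := r4
  rw [hρ, hτ] at r2'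
  rw [hρ', hτ'] at r4'
  set e := Equiv.prodAssoc α γ β
  set e' := Equiv.refl (α × γ)
  have htr : ∑ j, p j = ∑ j, p' j := by
    have h1 : trace (M1 * M1ᴴ) = trace (M3 * M3ᴴ) := by
      rw [← r1]
      simp [trace, ptSnd, Fintype.sum_prod_type]
    rw [hρ, hρ', trace_mul_comm, ← Matrix.mul_assoc, hV, trace_mul_comm (V' * _),
      ← Matrix.mul_assoc, hV1, Matrix.one_mul, Matrix.one_mul, trace_diagonal, trace_diagonal] at h1
    exact_mod_cast h1
  have hpt : ptSnd (liftU e U0 * diagonal (fun i : α × γ × β => (q i.2 : ℂ)) * (liftU e U0)ᴴ) =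
      liftU e' U0' * diagonal (fun i : α × γ => (q' i.2 : ℂ)) * (liftU e' U0')ᴴ := by
    ext x y
    rw [liftU_conj e' U0' (fun k => (q' k : ℂ)), ← hτ', ← r3]
    simp only [ptSnd, Matrix.of_apply]
    simp only [liftU_conj e U0 (fun k => (q k : ℂ)), ← hτ]
    change ∑ k, (if x.1 = y.1 then (M4 * M4ᴴ) (x.2, k) (y.2, k) else 0) =
      if x.1 = y.1 then ∑ k, (M4 * M4ᴴ) (x.2, k) (y.2, k) else 0
    split_ifs <;> simp
  have key := relent_real (fun i j => Complex.normSq (((liftU e U0)ᴴ * V) i j)) p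
    (fun i : α × γ × β => q i.2) hp (fun i => hq i.2)
    (fun j => col_sum _ _ (liftU_right e U0 hUU0) hV j)
    (fun i hi j => lift_supp e U0 V p hp q hU0 r2' i hi j)
    (fun i j => Complex.normSq (((liftU e' U0')ᴴ * V') i j)) p'
    (fun i : α × γ => q' i.2) hp' (fun i => hq' i.2)
    (fun j => col_sum _ _ (liftU_right e' U0' hUU0') hV1 j)
    (fun i hi j => lift_supp e' U0' V' p' hp' q' hU0' r4' i hi j) htr (by
      intro t ht
      obtain ⟨X, hX⟩ := vfun_attain t ht V' (liftU e' U0') p' (fun i : α × γ => q' i.2) hp'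
        (fun i => hq' i.2) hV1 (liftU_left e' U0' hU0')
      rw [← hX, ← hpt, ← hρ', ← r1, ← vfun_kron, hρ]
      exact vfun_le t ht V (liftU e U0) p (fun i : α × γ × β => q i.2) hp (fun i => hq i.2) hV
        (liftU_left e U0 hU0) hV' (liftU_right e U0 hUU0) _)
  rw [lift_log e U0 V p q hU0 r2', lift_log e' U0' V' p' q' hU0' r4'] at key
  have hl : 0 < Real.log 2 := Real.log_pos one_lt_two
  rw [← add_div, ← add_div]
  refine div_le_div_of_nonneg_right ?_ hl.le
  linarith

lemma Hm_isoT {K E F T : Type} [Fintype K] [DecidableEq K] [Fintype T]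
    [Fintype E] [Fintype F] (Φ : K → T × E → ℂ) (Φ' : K → T × F → ℂ)
    (W : E → F → ℂ) (h1 : ∀ k f t, Φ' k (t, f) = ∑ e, W e f * Φ k (t, e))
    (h2 : ∀ k e t, Φ k (t, e) = ∑ f, star (W e f) * Φ' k (t, f)) : Hm Φ' = Hm Φ := by
  unfold Hm
  congr 1
  ext s t
  simp only [mul_apply, conjTranspose_apply, Matrix.of_apply, Fintype.sum_prod_type]
  refine Finset.sum_congr rfl fun k _ => ?_
  calc ∑ f, Φ' s (k, f) * star (Φ' t (k, f))
      = ∑ f, ∑ e, (W e f * Φ s (k, e)) * star (Φ' t (k, f)) := by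
        refine Finset.sum_congr rfl fun f _ => ?_
        rw [h1 s f k, Finset.sum_mul]
    _ = ∑ e, ∑ f, (W e f * Φ s (k, e)) * star (Φ' t (k, f)) := Finset.sum_comm
    _ = _ := by
        refine Finset.sum_congr rfl fun e _ => ?_
        rw [h2 t e k, star_sum, Finset.mul_sum]
        refine Finset.sum_congr rfl fun f _ => ?_
        rw [star_mul', star_star]
        ring

lemma SSA_use {α β γ δ : Type} [Fintype α] [DecidableEq α] [Fintype β] [DecidableEq β]
    [Fintype γ] [DecidableEq γ] [Fintype δ] (Φ : α → β → γ → δ → ℂ) (h1 h2 h3 h4 : ℝ)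
    (e1 : Hm (fun (x : (α × γ) × β) (d : δ) => Φ x.1.1 x.2 x.1.2 d) = h1)
    (e2 : Hm (fun (c : γ) (y : β × α × δ) => Φ y.2.1 y.1 c y.2.2) = h2)
    (e3 : Hm (fun (x : α × γ) (y : β × δ) => Φ x.1 y.1 x.2 y.2) = h3)
    (e4 : Hm (fun (x : γ × β) (y : α × δ) => Φ y.1 x.2 x.1 y.2) = h4) :
    h1 + h2 ≤ h3 + h4 := by
  rw [← e1, ← e2, ← e3, ← e4]
  exact SSA Φ

/-- conditional mutual information of a four-party vector -/
noncomputable def cm {A B E R : Type} [Fintype A] [DecidableEq A] [Fintype B] [DecidableEq B]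
    [Fintype E] [DecidableEq E] [Fintype R] (Φ : A → B → E → R → ℂ) : ℝ :=
  Hm (fun (x : A × E) (y : B × R) => Φ x.1 y.1 x.2 y.2)
    + Hm (fun (x : B × E) (y : A × R) => Φ y.1 x.1 x.2 y.2)
    - Hm (fun (x : A × B × E) (r : R) => Φ x.1 x.2.1 x.2.2 r)
    - Hm (fun (e : E) (y : B × A × R) => Φ y.2.1 y.1 e y.2.2)

lemma cm_nonneg {A B E R : Type} [Fintype A] [DecidableEq A] [Fintype B] [DecidableEq B]
    [Fintype E] [DecidableEq E] [Fintype R] (Φ : A → B → E → R → ℂ) : 0 ≤ cm Φ := by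
  have := SSA_use Φ _ _ _ _
    (Hm_congr _ (fun (x : A × B × E) (r : R) => Φ x.1 x.2.1 x.2.2 r)
      ⟨fun x => (x.1.1, x.2, x.1.2), fun x => ((x.1, x.2.2), x.2.1), fun _ => rfl, fun _ => rfl⟩
      (Equiv.refl _) (fun _ _ => rfl)) rfl rfl
    (Hm_congr _ (fun (x : B × E) (y : A × R) => Φ y.1 x.1 x.2 y.2) (Equiv.prodComm _ _)
      (Equiv.refl _) (fun _ _ => rfl))
  unfold cm
  linarith

lemma cm_reindex {A B E E' R : Type} [Fintype A] [DecidableEq A] [Fintype B] [DecidableEq B]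
    [Fintype E] [DecidableEq E] [Fintype E'] [DecidableEq E'] [Fintype R] (Φ : A → B → E → R → ℂ)
    (g : E' ≃ E) : cm (fun a b e r => Φ a b (g e) r) = cm Φ := by
  unfold cm
  congr 1
  · congr 1
    · congr 1
      · exact Hm_congr _ _ (Equiv.prodCongr (Equiv.refl _) g) (Equiv.refl _) (fun _ _ => rfl)
      · exact Hm_congr _ _ (Equiv.prodCongr (Equiv.refl _) g) (Equiv.refl _) (fun _ _ => rfl)
    · exact Hm_congr _ _ (Equiv.prodCongr (Equiv.refl _) (Equiv.prodCongr (Equiv.refl _) g))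
        (Equiv.refl _) (fun _ _ => rfl)
  · exact Hm_congr _ _ g (Equiv.refl _) (fun _ _ => rfl)

lemma cmi_eq_cm {A B E R : Type} [Fintype A] [DecidableEq A] [Fintype B] [DecidableEq B]
    [Fintype E] [DecidableEq E] [Fintype R] (Φ : A → B → E → R → ℂ)
    (ρ : Matrix (A × B × E) (A × B × E) ℂ)
    (h : ∀ x y, ρ x y = ∑ r, Φ x.1 x.2.1 x.2.2 r * star (Φ y.1 y.2.1 y.2.2 r)) :
    cmi ρ = cm Φ := by
  unfold cmi cm Hm
  congr 1
  · congr 1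
    · congr 1
      · congr 1
        ext x y
        simp [ptMid, h, mul_apply, Fintype.sum_prod_type]
      · congr 1
        ext x y
        simp [ptFst, h, mul_apply, Fintype.sum_prod_type]
    · congr 1
      ext x y
      simp [h, mul_apply]
  · congr 1
    ext x y
    simp [ptFst, h, mul_apply, Fintype.sum_prod_type]

/-- vector after the Stinespring dilation of the squashing channel -/
noncomputable def dil {A B : Type} {e e' : ℕ} (φ : (A × B) × Fin e → ℂ) (S : Kraus (Fin e) (Fin e')) :
    A → B → Fin e' → S.R → ℂ := fun a b k r => ∑ i, S.K r k i * φ ((a, b), i)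

lemma cmi_squash {A B : Type} [Fintype A] [Fintype B] [DecidableEq A] [DecidableEq B]
    {e e' : ℕ} (φ : (A × B) × Fin e → ℂ) (S : Kraus (Fin e) (Fin e')) :
    cmi (squash (pureMat φ) S) = cm (dil φ S) := by
  refine cmi_eq_cm _ _ fun x y => ?_
  simp only [squash, submatrix_apply, Matrix.sum_apply]
  refine Finset.sum_congr rfl fun r _ => ?_
  have h1 : pureMat φ = Matrix.of (fun (i : (A × B) × Fin e) (_ : Unit) => φ i) *
      (Matrix.of (fun (i : (A × B) × Fin e) (_ : Unit) => φ i))ᴴ := by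
    ext i j
    simp [pureMat, mul_apply]
  rw [h1, ← Matrix.mul_assoc, Matrix.mul_assoc, ← conjTranspose_mul, mul_apply]
  simp only [Finset.univ_unique, Finset.sum_singleton, conjTranspose_apply]
  have h2 : ∀ x : A × B × Fin e', (((1 : Matrix (A × B) (A × B) ℂ) ⊗ₖ S.K r) *
      Matrix.of (fun (i : (A × B) × Fin e) (_ : Unit) => φ i))
      ((Equiv.prodAssoc A B (Fin e')).symm x) default = dil φ S x.1 x.2.1 x.2.2 r := by
    intro x
    simp only [mul_apply, Fintype.sum_prod_type (α₁ := A × B), kroneckerMap_apply, dil, Matrix.of_apply,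
      one_apply, ite_mul, one_mul, zero_mul]
    rw [Finset.sum_comm]
    simp
  rw [h2, h2]

lemma dil_marg {A B : Type} {e e' : ℕ} (φ : (A × B) × Fin e → ℂ) (S : Kraus (Fin e) (Fin e'))
    (x y : A × B) :
    ∑ f : Fin e' × S.R, dil φ S x.1 x.2 f.1 f.2 * star (dil φ S y.1 y.2 f.1 f.2) =
      ptSnd (pureMat φ) x y := by
  have htp : ∀ i j, ∑ r, ∑ k, star (S.K r k i) * S.K r k j = if i = j then 1 else 0 := by
    intro i j
    have := congrFun (congrFun S.tp i) j
    simpa only [Matrix.sum_apply, mul_apply, conjTranspose_apply, one_apply] using this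
  simp only [ptSnd, pureMat, Matrix.of_apply]
  calc _ = ∑ f : Fin e' × S.R, ∑ j, ∑ i, (φ (x, j) * star (φ (y, i))) *
          (star (S.K f.2 f.1 i) * S.K f.2 f.1 j) := by
        refine Finset.sum_congr rfl fun f _ => ?_
        simp only [dil, star_sum, Finset.sum_mul_sum]
        refine Finset.sum_congr rfl fun j _ => Finset.sum_congr rfl fun i _ => ?_
        rw [star_mul']
        ring
    _ = ∑ j, ∑ i, (φ (x, j) * star (φ (y, i))) * (if i = j then 1 else 0) := by
        rw [Finset.sum_comm]
        refine Finset.sum_congr rfl fun j _ => ?_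
        rw [Finset.sum_comm]
        refine Finset.sum_congr rfl fun i _ => ?_
        rw [← Finset.mul_sum, ← htp, Fintype.sum_prod_type, Finset.sum_comm]
    _ = _ := by simp

/-- the set in the definition of `EsqState` -/
def EsqSet {A B : Type} [Fintype A] [Fintype B] [DecidableEq A] [DecidableEq B]
    (ρ : Matrix (A × B) (A × B) ℂ) : Set ℝ := { x : ℝ | ∃ (e : ℕ) (ψ : (A × B) × Fin e → ℂ),
    ptSnd (pureMat ψ) = ρ ∧ ∃ (e' : ℕ) (S : Kraus (Fin e) (Fin e')),
      x = cmi (squash (pureMat ψ) S) }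

lemma EsqSet_bdd {A B : Type} [Fintype A] [Fintype B] [DecidableEq A] [DecidableEq B]
    (ρ : Matrix (A × B) (A × B) ℂ) : BddBelow (EsqSet ρ) := by
  refine ⟨0, ?_⟩
  rintro x ⟨e, φ, _, e', S, rfl⟩
  rw [cmi_squash]
  exact cm_nonneg _

lemma mem_EsqSet {A B : Type} [Fintype A] [Fintype B] [DecidableEq A] [DecidableEq B]
    (ρ : Matrix (A × B) (A × B) ℂ) {e' : ℕ} {R : Type} [Fintype R] [DecidableEq R]
    (Φ : A → B → Fin e' → R → ℂ)
    (h : ∀ x y : A × B, ∑ f : Fin e' × R, Φ x.1 x.2 f.1 f.2 * star (Φ y.1 y.2 f.1 f.2) = ρ x y) :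
    cm Φ ∈ EsqSet ρ := by
  let g := Fintype.equivFin (Fin e' × R)
  let S : Kraus (Fin (Fintype.card (Fin e' × R))) (Fin e') :=
    { R := R
      fintypeR := inferInstance
      K := fun r => Matrix.of fun k i => if g.symm i = (k, r) then 1 else 0
      tp := by
        ext i j
        simp only [Matrix.sum_apply, mul_apply, conjTranspose_apply, Matrix.of_apply, one_apply]
        rw [Finset.sum_comm, ← Fintype.sum_prod_type'
          (f := fun k r => star (if g.symm i = (k, r) then (1:ℂ) else 0) *
            (if g.symm j = (k, r) then (1:ℂ) else 0))]
        simp [apply_ite star, eq_comm] }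
  refine ⟨_, fun x => Φ x.1.1 x.1.2 (g.symm x.2).1 (g.symm x.2).2, ?_, e', S, ?_⟩
  · ext x y
    rw [← h]
    simp only [ptSnd, pureMat, Matrix.of_apply]
    exact g.symm.sum_comp (fun f => Φ x.1 x.2 f.1 f.2 * star (Φ y.1 y.2 f.1 f.2))
  · rw [cmi_squash]
    have : dil (fun x => Φ x.1.1 x.1.2 (g.symm x.2).1 (g.symm x.2).2) S = Φ := by
      funext a b k r
      simp only [dil, S, Matrix.of_apply]
      rw [← g.sum_comp]
      simp
    rw [this]

open scoped ComplexOrder in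
lemma exists_W {X E F : Type} [Fintype X] [DecidableEq X] [Fintype E] [Fintype F]
    (P : X → E → ℂ) (Q : X → F → ℂ)
    (h : ∀ x y, ∑ e, P x e * star (P y e) = ∑ f, Q x f * star (Q y f)) :
    ∃ W : E → F → ℂ, (∀ x f, Q x f = ∑ e, W e f * P x e) ∧
      (∀ x e, P x e = ∑ f, star (W e f) * Q x f) := by
  set MP := Matrix.of P
  set MQ := Matrix.of Q
  have hG : MP * MPᴴ = MQ * MQᴴ := by
    ext x y
    simpa [mul_apply, MP, MQ] using h x y
  obtain ⟨V, p, hV, hV', hp, hρ, -⟩ := diag_exists _ (posSemidef_self_mul_conjTranspose MP)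
  set H := V * diagonal (fun j => (((p j)⁻¹ : ℝ) : ℂ)) * Vᴴ with hH
  have hHh : Hᴴ = H := by
    rw [hH]
    simp only [conjTranspose_mul, conjTranspose_conjTranspose, Matrix.mul_assoc,
      diagonal_conjTranspose]
    congr 3
    ext j
    simp
  have hGHG : (MP * MPᴴ) * H * (MP * MPᴴ) = MP * MPᴴ := by
    rw [hρ, hH]
    have : V * diagonal (fun j => (p j : ℂ)) * Vᴴ * (V * diagonal (fun j => (((p j)⁻¹ : ℝ) : ℂ)) * Vᴴ) *
      (V * diagonal (fun j => (p j : ℂ)) * Vᴴ) = V * (diagonal (fun j => (p j : ℂ)) * (Vᴴ * V) *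
      diagonal (fun j => (((p j)⁻¹ : ℝ) : ℂ)) * (Vᴴ * V) * diagonal (fun j => (p j : ℂ))) * Vᴴ := by
      simp only [Matrix.mul_assoc]
    rw [this, hV, Matrix.mul_one, Matrix.mul_one, diagonal_mul_diagonal, diagonal_mul_diagonal]
    congr 3
    ext j
    by_cases hj : p j = 0
    · simp [hj]
    · have : (p j : ℂ) ≠ 0 := by exact_mod_cast hj
      push_cast
      field_simp
  have gen : ∀ {F : Type} [Fintype F] (M : Matrix X F ℂ), M * Mᴴ = MP * MPᴴ →
      (MP * MPᴴ) * H * M = M := by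
    intro F _ M hM
    have h0 : ((MP * MPᴴ) * H * M - M) * ((MP * MPᴴ) * H * M - M)ᴴ = 0 := by
      have : ((MP * MPᴴ) * H * M - M) * Mᴴ = 0 := by
        rw [Matrix.sub_mul, Matrix.mul_assoc _ M, hM, hGHG, sub_self]
      rw [conjTranspose_sub, conjTranspose_mul, Matrix.mul_sub, ← Matrix.mul_assoc, this]
      simp
    exact sub_eq_zero.1 (self_mul_conjTranspose_eq_zero.1 h0)
  have g1 := gen MP rfl
  have g2 := gen MQ hG.symm
  set W := MPᴴ * H * MQ with hW
  have w1 : MP * W = MQ := by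
    rw [hW, ← Matrix.mul_assoc, ← Matrix.mul_assoc, g2]
  have w2 : MQ * Wᴴ = MP := by
    rw [hW, conjTranspose_mul, conjTranspose_mul, conjTranspose_conjTranspose, hHh,
      ← Matrix.mul_assoc, ← hG, ← Matrix.mul_assoc, g1]
  refine ⟨W, fun x f => ?_, fun x e => ?_⟩
  · have := congrFun (congrFun w1 x) f
    rw [mul_apply] at this
    simp only [mul_comm (W _ _)]
    exact this.symm
  · have := congrFun (congrFun w2 x) e
    rw [mul_apply] at this
    simp only [mul_comm (star _)]
    exact this.symm

lemma iso_sum {E F : Type} [Fintype E] [Fintype F] (P P' : E → ℂ) (Q Q' : F → ℂ) (W : E → F → ℂ)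
    (h1 : ∀ f, Q f = ∑ e, W e f * P e) (h2 : ∀ e, P' e = ∑ f, star (W e f) * Q' f) :
    ∑ f, Q f * star (Q' f) = ∑ e, P e * star (P' e) := by
  simp only [h1, h2, star_sum, Finset.sum_mul, Finset.mul_sum]
  rw [Finset.sum_comm]
  refine Finset.sum_congr rfl fun e _ => Finset.sum_congr rfl fun f _ => ?_
  rw [star_mul', star_star]
  ring

lemma cm_reindexA {A A' B E R : Type} [Fintype A] [DecidableEq A] [Fintype B] [DecidableEq B]
    [Fintype E] [DecidableEq E] [Fintype A'] [DecidableEq A'] [Fintype R] (Φ : A → B → E → R → ℂ)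
    (g : A' ≃ A) : cm (fun a b e r => Φ (g a) b e r) = cm Φ := by
  unfold cm
  congr 1
  · congr 1
    · congr 1
      · exact Hm_congr _ _ (Equiv.prodCongr g (Equiv.refl _)) (Equiv.refl _) (fun _ _ => rfl)
      · exact Hm_congr _ _ (Equiv.refl _) (Equiv.prodCongr g (Equiv.refl _)) (fun _ _ => rfl)
    · exact Hm_congr _ _ (Equiv.prodCongr g (Equiv.refl _))
        (Equiv.refl _) (fun _ _ => rfl)
  · exact Hm_congr _ _ (Equiv.refl _)
      (Equiv.prodCongr (Equiv.refl _) (Equiv.prodCongr g (Equiv.refl _))) (fun _ _ => rfl)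

lemma cm_aux1 {C E B K R : Type} [Fintype C] [DecidableEq C] [Fintype E] [DecidableEq E]
    [Fintype B] [DecidableEq B] [Fintype K] [DecidableEq K]
    [Fintype R] [DecidableEq R] (Φ : C × E → B → K → R → ℂ) :
    Hm (fun (x : (C × E) × K) (y : B × R) => Φ x.1 y.1 x.2 y.2) =
    Hm (fun (x : (C × K) × E) (y : B × R) => Φ (x.1.1, x.2) y.1 x.1.2 y.2) := by
  let e : (C × E) × K ≃ (C × K) × E := ⟨fun x => ((x.1.1, x.2), x.1.2),
    fun x => ((x.1.1, x.2), x.1.2), fun _ => rfl, fun _ => rfl⟩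
  apply Hm_congr _ _ e (Equiv.refl _)
  intro k t
  rfl

lemma cm_aux2 {C E B K R : Type} [Fintype C] [DecidableEq C] [Fintype E] [DecidableEq E]
    [Fintype B] [DecidableEq B] [Fintype K] [DecidableEq K]
    [Fintype R] [DecidableEq R] (Φ : C × E → B → K → R → ℂ) :
    Hm (fun (x : B × K) (y : (C × E) × R) => Φ y.1 x.1 x.2 y.2) =
    Hm (fun (x : B × K) (y : (C × R) × E) => Φ (y.1.1, y.2) x.1 x.2 y.1.2) := by
  let e : (C × E) × R ≃ (C × R) × E := ⟨fun x => ((x.1.1, x.2), x.1.2),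
    fun x => ((x.1.1, x.2), x.1.2), fun _ => rfl, fun _ => rfl⟩
  apply Hm_congr _ _ (Equiv.refl _) e
  intro k t
  rfl

lemma cm_aux3 {C E B K R : Type} [Fintype C] [DecidableEq C] [Fintype E] [DecidableEq E]
    [Fintype B] [DecidableEq B] [Fintype K] [DecidableEq K]
    [Fintype R] [DecidableEq R] (Φ : C × E → B → K → R → ℂ) :
    Hm (fun (x : (C × E) × B × K) (r : R) => Φ x.1 x.2.1 x.2.2 r) =
    Hm (fun (x : (C × B × K) × E) (r : R) => Φ (x.1.1, x.2) x.1.2.1 x.1.2.2 r) := by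
  let e : (C × E) × B × K ≃ (C × B × K) × E := ⟨fun x => ((x.1.1, x.2), x.1.2),
    fun x => ((x.1.1, x.2), x.1.2), fun _ => rfl, fun _ => rfl⟩
  apply Hm_congr _ _ e (Equiv.refl _)
  intro k t
  rfl

lemma cm_aux4 {C E B K R : Type} [Fintype C] [DecidableEq C] [Fintype E] [DecidableEq E]
    [Fintype B] [DecidableEq B] [Fintype K] [DecidableEq K]
    [Fintype R] [DecidableEq R] (Φ : C × E → B → K → R → ℂ) :
    Hm (fun (k : K) (y : B × (C × E) × R) => Φ y.2.1 y.1 k y.2.2) =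
    Hm (fun (k : K) (y : (B × C × R) × E) => Φ (y.1.2.1, y.2) y.1.1 k y.1.2.2) := by
  let e : B × (C × E) × R ≃ (B × C × R) × E := ⟨fun x => ((x.1, x.2.1.1, x.2.2), x.2.1.2),
    fun x => (x.1.1, (x.1.2.1, x.2), x.1.2.2), fun _ => rfl, fun _ => rfl⟩
  apply Hm_congr _ _ (Equiv.refl _) e
  intro k t
  rfl

lemma cm_iso {C E F B K R : Type} [Fintype C] [DecidableEq C] [Fintype E] [DecidableEq E]
    [Fintype F] [DecidableEq F] [Fintype B] [DecidableEq B] [Fintype K] [DecidableEq K]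
    [Fintype R] [DecidableEq R] (Φ : C × E → B → K → R → ℂ) (Φ' : C × F → B → K → R → ℂ)
    (W : E → F → ℂ) (h1 : ∀ c f b k r, Φ' (c, f) b k r = ∑ e, W e f * Φ (c, e) b k r)
    (h2 : ∀ c e b k r, Φ (c, e) b k r = ∑ f, star (W e f) * Φ' (c, f) b k r) :
    cm Φ' = cm Φ := by
  have i1 := Hm_iso (fun (x : (C × K) × E) (y : B × R) => Φ (x.1.1, x.2) y.1 x.1.2 y.2)
    (fun (x : (C × K) × F) (y : B × R) => Φ' (x.1.1, x.2) y.1 x.1.2 y.2) W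
    (fun k f t => h1 k.1 f t.1 k.2 t.2) (fun k e t => h2 k.1 e t.1 k.2 t.2)
  have i2 := Hm_isoT (fun (x : B × K) (y : (C × R) × E) => Φ (y.1.1, y.2) x.1 x.2 y.1.2)
    (fun (x : B × K) (y : (C × R) × F) => Φ' (y.1.1, y.2) x.1 x.2 y.1.2) W
    (fun k f t => h1 t.1 f k.1 k.2 t.2) (fun k e t => h2 t.1 e k.1 k.2 t.2)
  have i3 := Hm_iso (fun (x : (C × B × K) × E) (r : R) => Φ (x.1.1, x.2) x.1.2.1 x.1.2.2 r)
    (fun (x : (C × B × K) × F) (r : R) => Φ' (x.1.1, x.2) x.1.2.1 x.1.2.2 r) W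
    (fun k f t => h1 k.1 f k.2.1 k.2.2 t) (fun k e t => h2 k.1 e k.2.1 k.2.2 t)
  have i4 := Hm_isoT (fun (k : K) (y : (B × C × R) × E) => Φ (y.1.2.1, y.2) y.1.1 k y.1.2.2)
    (fun (k : K) (y : (B × C × R) × F) => Φ' (y.1.2.1, y.2) y.1.1 k y.1.2.2) W
    (fun k f t => h1 t.2.1 f t.1 k t.2.2) (fun k e t => h2 t.2.1 e t.1 k t.2.2)
  unfold cm
  rw [cm_aux1 Φ, cm_aux1 Φ', cm_aux2 Φ, cm_aux2 Φ', cm_aux3 Φ, cm_aux3 Φ', cm_aux4 Φ, cm_aux4 Φ',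
    i1, i2, i3, i4]

set_option maxHeartbeats 4000000 in
lemma main_ineq {A B1 B2 K1 R1 K2 R2 : Type} [Fintype A] [DecidableEq A] [Fintype B1]
    [DecidableEq B1] [Fintype B2] [DecidableEq B2] [Fintype K1] [DecidableEq K1]
    [Fintype K2] [DecidableEq K2] [Fintype R1] [DecidableEq R1] [Fintype R2] [DecidableEq R2]
    (Ψ : A → B1 → B2 → K1 → R1 → K2 → R2 → ℂ) :
    cm (fun (a : A) (b : B1 × B2) (k : K1 × K2) (r : R1 × R2) => Ψ a b.1 b.2 k.1 r.1 k.2 r.2) ≤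
    cm (fun (x : (A × B2) × (K2 × R2)) (b1 : B1) (k1 : K1) (r1 : R1) =>
        Ψ x.1.1 b1 x.1.2 k1 r1 x.2.1 x.2.2) +
    cm (fun (x : (A × B1) × (K1 × R1)) (b2 : B2) (k2 : K2) (r2 : R2) =>
        Ψ x.1.1 x.1.2 b2 x.2.1 x.2.2 k2 r2) := by
  obtain ⟨hA, eA⟩ : ∃ h, h = Hm (fun (x : A × (K1 × K2)) (y : (B1 × B2) × (R1 × R2)) =>
    Ψ x.1 y.1.1 y.1.2 x.2.1 y.2.1 x.2.2 y.2.2) := ⟨_, rfl⟩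
  obtain ⟨hBB, eBB⟩ : ∃ h, h = Hm (fun (x : (B1 × B2) × (K1 × K2)) (y : A × (R1 × R2)) =>
    Ψ y.1 x.1.1 x.1.2 x.2.1 y.2.1 x.2.2 y.2.2) := ⟨_, rfl⟩
  obtain ⟨hAB, eAB⟩ : ∃ h, h = Hm (fun (x : A × (B1 × B2) × (K1 × K2)) (y : R1 × R2) =>
    Ψ x.1 x.2.1.1 x.2.1.2 x.2.2.1 y.1 x.2.2.2 y.2) := ⟨_, rfl⟩
  obtain ⟨hKK, eKK⟩ : ∃ h, h = Hm (fun (x : K1 × K2) (y : (B1 × B2) × A × (R1 × R2)) =>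
    Ψ y.2.1 y.1.1 y.1.2 x.1 y.2.2.1 x.2 y.2.2.2) := ⟨_, rfl⟩
  obtain ⟨hRA2, eRA2⟩ : ∃ h, h = Hm (fun (x : ((A × B2) × (K2 × R2)) × K1) (y : B1 × R1) =>
    Ψ x.1.1.1 y.1 x.1.1.2 x.2 y.2 x.1.2.1 x.1.2.2) := ⟨_, rfl⟩
  obtain ⟨hB1, eB1⟩ : ∃ h, h = Hm (fun (x : B1 × K1) (y : ((A × B2) × (K2 × R2)) × R1) =>
    Ψ y.1.1.1 x.1 y.1.1.2 x.2 y.2 y.1.2.1 y.1.2.2) := ⟨_, rfl⟩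
  obtain ⟨hR2, eR2⟩ : ∃ h, h = Hm (fun (x : ((A × B2) × (K2 × R2)) × B1 × K1) (y : R1) =>
    Ψ x.1.1.1 x.2.1 x.1.1.2 x.2.2 y x.1.2.1 x.1.2.2) := ⟨_, rfl⟩
  obtain ⟨hK1, eK1⟩ : ∃ h, h = Hm (fun (x : K1) (y : B1 × ((A × B2) × (K2 × R2)) × R1) =>
    Ψ y.2.1.1.1 y.1 y.2.1.1.2 x y.2.2 y.2.1.2.1 y.2.1.2.2) := ⟨_, rfl⟩
  obtain ⟨hRA1, eRA1⟩ : ∃ h, h = Hm (fun (x : ((A × B1) × (K1 × R1)) × K2) (y : B2 × R2) =>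
    Ψ x.1.1.1 x.1.1.2 y.1 x.1.2.1 x.1.2.2 x.2 y.2) := ⟨_, rfl⟩
  obtain ⟨hB2, eB2⟩ : ∃ h, h = Hm (fun (x : B2 × K2) (y : ((A × B1) × (K1 × R1)) × R2) =>
    Ψ y.1.1.1 y.1.1.2 x.1 y.1.2.1 y.1.2.2 x.2 y.2) := ⟨_, rfl⟩
  obtain ⟨hR1, eR1⟩ : ∃ h, h = Hm (fun (x : ((A × B1) × (K1 × R1)) × B2 × K2) (y : R2) =>
    Ψ x.1.1.1 x.1.1.2 x.2.1 x.1.2.1 x.1.2.2 x.2.2 y) := ⟨_, rfl⟩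
  obtain ⟨hK2, eK2⟩ : ∃ h, h = Hm (fun (x : K2) (y : B2 × ((A × B1) × (K1 × R1)) × R2) =>
    Ψ y.2.1.1.1 y.2.1.1.2 y.1 y.2.1.2.1 y.2.1.2.2 x y.2.2) := ⟨_, rfl⟩
  obtain ⟨hA1, eA1⟩ : ∃ h, h = Hm (fun (x : (A × K1 × K2) × B1) (y : (B2 × R2) × R1) =>
    Ψ x.1.1 x.2 y.1.1 x.1.2.1 y.2 x.1.2.2 y.1.2) := ⟨_, rfl⟩
  obtain ⟨hB1KK, eB1KK⟩ : ∃ h, h = Hm (fun (x : (K2 × K1) × B1) (y : A × B2 × R1 × R2) =>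
    Ψ y.1 x.2 y.2.1 x.1.2 y.2.2.1 x.1.1 y.2.2.2) := ⟨_, rfl⟩
  have s1 := SSA_use (α := B2 × R2) (β := B1) (γ := A × K1 × K2) (δ := R1)
    (fun x b1 y r1 => Ψ y.1 b1 x.1 y.2.1 r1 y.2.2 x.2) hR2 hA hRA2 hA1
    (by
      rw [eR2]
      exact Hm_congr _ _ ⟨fun x => (((x.1.2.1, x.1.1.1), (x.1.2.2.2, x.1.1.2)), x.2, x.1.2.2.1),
        fun z => (((z.1.1.2, z.1.2.2), (z.1.1.1, z.2.2, z.1.2.1)), z.2.1), fun _ => rfl,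
        fun _ => rfl⟩ (Equiv.refl _) (fun _ _ => rfl))
    (by
      rw [eA]
      exact Hm_congr _ _ (Equiv.refl _) ⟨fun y => ((y.1, y.2.1.1), (y.2.2, y.2.1.2)),
        fun z => (z.1.1, (z.1.2, z.2.2), z.2.1), fun _ => rfl, fun _ => rfl⟩ (fun _ _ => rfl))
    (by
      rw [eRA2]
      exact Hm_congr _ _ ⟨fun x => (((x.2.1, x.1.1), (x.2.2.2, x.1.2)), x.2.2.1),
        fun z => ((z.1.1.2, z.1.2.2), (z.1.1.1, z.2, z.1.2.1)), fun _ => rfl,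
        fun _ => rfl⟩ (Equiv.refl _) (fun _ _ => rfl))
    eA1.symm
  have s3 := SSA_use (α := R1) (β := B2) (γ := (A × K1 × K2) × B1) (δ := R2)
    (fun r1 b2 g r2 => Ψ g.1.1 g.2 b2 g.1.2.1 r1 g.1.2.2 r2) hR1 hA1 hRA1 hAB
    (by
      rw [eR1]
      exact Hm_congr _ _ ⟨fun x => (((x.1.2.1.1, x.1.2.2), (x.1.2.1.2.1, x.1.1)), x.2, x.1.2.1.2.2),
        fun z => ((z.1.2.2, ((z.1.1.1, z.1.2.1, z.2.2), z.1.1.2)), z.2.1), fun _ => rfl,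
        fun _ => rfl⟩ (Equiv.refl _) (fun _ _ => rfl))
    (by
      rw [eA1]
      exact Hm_congr _ _ (Equiv.refl _) ⟨fun y => ((y.1, y.2.2), y.2.1),
        fun z => (z.1.1, z.2, z.1.2), fun _ => rfl, fun _ => rfl⟩ (fun _ _ => rfl))
    (by
      rw [eRA1]
      exact Hm_congr _ _ ⟨fun x => (((x.2.1.1, x.2.2), (x.2.1.2.1, x.1)), x.2.1.2.2),
        fun z => (z.1.2.2, ((z.1.1.1, z.1.2.1, z.2), z.1.1.2)), fun _ => rfl,
        fun _ => rfl⟩ (Equiv.refl _) (fun _ _ => rfl))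
    (by
      rw [eAB]
      exact Hm_congr _ _ ⟨fun x => (x.1.1.1, (x.1.2, x.2), x.1.1.2),
        fun z => (((z.1, z.2.2), z.2.1.1), z.2.1.2), fun _ => rfl,
        fun _ => rfl⟩ (Equiv.refl _) (fun _ _ => rfl))
  have s2 := SSA_use (α := K2) (β := B1) (γ := K1) (δ := A × B2 × R1 × R2)
    (fun k2 b1 k1 d => Ψ d.1 b1 d.2.1 k1 d.2.2.1 k2 d.2.2.2) hB1KK hK1 hKK hB1
    eB1KK.symm
    (by
      rw [eK1]
      exact Hm_congr _ _ (Equiv.refl _)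
        ⟨fun y => (y.1, ((y.2.2.1, y.2.2.2.1), (y.2.1, y.2.2.2.2.2)), y.2.2.2.2.1),
        fun z => (z.1, z.2.1.2.1, (z.2.1.1.1, z.2.1.1.2, z.2.2, z.2.1.2.2)), fun _ => rfl,
        fun _ => rfl⟩ (fun _ _ => rfl))
    (by
      rw [eKK]
      exact Hm_congr _ _ (Equiv.prodComm _ _)
        ⟨fun y => ((y.1, y.2.2.1), y.2.1, (y.2.2.2.1, y.2.2.2.2)),
        fun z => (z.1.1, z.2.1, z.1.2, z.2.2.1, z.2.2.2), fun _ => rfl,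
        fun _ => rfl⟩ (fun _ _ => rfl))
    (by
      rw [eB1]
      exact Hm_congr _ _ (Equiv.prodComm _ _)
        ⟨fun y => (((y.2.1, y.2.2.1), (y.1, y.2.2.2.2)), y.2.2.2.1),
        fun z => (z.1.2.1, z.1.1.1, z.1.1.2, z.2, z.1.2.2), fun _ => rfl,
        fun _ => rfl⟩ (fun _ _ => rfl))
  have s4 := SSA_use (α := B1 × K1) (β := B2) (γ := K2) (δ := A × R1 × R2)
    (fun x b2 k2 d => Ψ d.1 x.1 b2 x.2 d.2.1 k2 d.2.2) hBB hK2 hB1KK hB2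
    (by
      rw [eBB]
      exact Hm_congr _ _ ⟨fun x => ((x.1.1.1, x.2), (x.1.1.2, x.1.2)),
        fun z => (((z.1.1, z.2.1), z.2.2), z.1.2), fun _ => rfl,
        fun _ => rfl⟩ (Equiv.refl _) (fun _ _ => rfl))
    (by
      rw [eK2]
      exact Hm_congr _ _ (Equiv.refl _)
        ⟨fun y => (y.1, ((y.2.2.1, y.2.1.1), (y.2.1.2, y.2.2.2.1)), y.2.2.2.2),
        fun z => (z.1, (z.2.1.1.2, z.2.1.2.1), (z.2.1.1.1, z.2.1.2.2, z.2.2)), fun _ => rfl,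
        fun _ => rfl⟩ (fun _ _ => rfl))
    (by
      rw [eB1KK]
      exact Hm_congr _ _ ⟨fun x => ((x.2, x.1.2), x.1.1), fun z => ((z.2, z.1.2), z.1.1),
        fun _ => rfl, fun _ => rfl⟩
        ⟨fun y => (y.2.1, y.1, y.2.2.1, y.2.2.2),
        fun z => (z.2.1, z.1, z.2.2.1, z.2.2.2), fun _ => rfl,
        fun _ => rfl⟩ (fun _ _ => rfl))
    (by
      rw [eB2]
      exact Hm_congr _ _ (Equiv.prodComm _ _)
        ⟨fun y => (((y.2.1, y.1.1), (y.1.2, y.2.2.1)), y.2.2.2),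
        fun z => ((z.1.1.2, z.1.2.1), (z.1.1.1, z.1.2.2, z.2)), fun _ => rfl,
        fun _ => rfl⟩ (fun _ _ => rfl))
  have fin : hA + hBB - hAB - hKK ≤ (hRA2 + hB1 - hR2 - hK1) + (hRA1 + hB2 - hR1 - hK2) := by
    linarith
  rw [eA, eBB, eAB, eKK, eRA2, eB1, eR2, eK1, eRA1, eB2, eR1, eK2] at fin
  exact fin

/-- **Subadditivity of squashed entanglement** (Theorem 2 of the paper):
for any five-party pure state ψ on A, B₁, E₁, B₂, E₂,
E_sq(A;B₁B₂) ≤ E_sq(AB₂E₂;B₁) + E_sq(AB₁E₁;B₂). -/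
theorem squashed_entanglement_subadditivity
    (a b1 e1 b2 e2 : ℕ)
    (ψ : Fin a × Fin b1 × Fin e1 × Fin b2 × Fin e2 → ℂ)
    (hψ : ∑ i, Complex.normSq (ψ i) = 1) :
    EsqState (Matrix.of fun (i j : Fin a × (Fin b1 × Fin b2)) =>
        ∑ x1 : Fin e1, ∑ x2 : Fin e2,
          ψ (i.1, i.2.1, x1, i.2.2, x2) * star (ψ (j.1, j.2.1, x1, j.2.2, x2)))
      ≤ EsqState (Matrix.of fun (i j : (Fin a × Fin b2 × Fin e2) × Fin b1) =>
          ∑ x1 : Fin e1,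
            ψ (i.1.1, i.2, x1, i.1.2.1, i.1.2.2) * star (ψ (j.1.1, j.2, x1, j.1.2.1, j.1.2.2)))
        + EsqState (Matrix.of fun (i j : (Fin a × Fin b1 × Fin e1) × Fin b2) =>
          ∑ x2 : Fin e2,
            ψ (i.1.1, i.1.2.1, i.1.2.2, i.2, x2) * star (ψ (j.1.1, j.1.2.1, j.1.2.2, j.2, x2))) := by
  classical
  set ρ0 := (Matrix.of fun (i j : Fin a × (Fin b1 × Fin b2)) =>
        ∑ x1 : Fin e1, ∑ x2 : Fin e2,
          ψ (i.1, i.2.1, x1, i.2.2, x2) * star (ψ (j.1, j.2.1, x1, j.2.2, x2))) with hρ0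
  set ρ1 := (Matrix.of fun (i j : (Fin a × Fin b2 × Fin e2) × Fin b1) =>
          ∑ x1 : Fin e1,
            ψ (i.1.1, i.2, x1, i.1.2.1, i.1.2.2) * star (ψ (j.1.1, j.2, x1, j.1.2.1, j.1.2.2))) with hρ1
  set ρ2 := (Matrix.of fun (i j : (Fin a × Fin b1 × Fin e1) × Fin b2) =>
          ∑ x2 : Fin e2,
            ψ (i.1.1, i.1.2.1, i.1.2.2, i.2, x2) * star (ψ (j.1.1, j.1.2.1, j.1.2.2, j.2, x2))) with hρ2
  have ne1 : (EsqSet ρ1).Nonempty := ⟨_, mem_EsqSet ρ1 (e' := e1) (R := Unit)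
    (fun x b k _ => ψ (x.1, b, k, x.2.1, x.2.2)) (by
      intro x y
      simp [hρ1, Fintype.sum_prod_type])⟩
  have ne2 : (EsqSet ρ2).Nonempty := ⟨_, mem_EsqSet ρ2 (e' := e2) (R := Unit)
    (fun x b k _ => ψ (x.1, x.2.1, x.2.2, b, k)) (by
      intro x y
      simp [hρ2, Fintype.sum_prod_type])⟩
  have key : ∀ x ∈ EsqSet ρ1, ∀ y ∈ EsqSet ρ2, sInf (EsqSet ρ0) ≤ x + y := by
    rintro _ ⟨f1, φ1, hφ1, f1', S1, rfl⟩ _ ⟨f2, φ2, hφ2, f2', S2, rfl⟩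
    rw [cmi_squash, cmi_squash]
    have m1 := dil_marg φ1 S1
    have m2 := dil_marg φ2 S2
    rw [hφ1] at m1
    rw [hφ2] at m2
    generalize dil φ1 S1 = Φ1 at m1 ⊢
    generalize dil φ2 S2 = Φ2 at m2 ⊢
    obtain ⟨W1, w1, w1'⟩ := exists_W
      (fun (i : (Fin a × Fin b2 × Fin e2) × Fin b1) (x1 : Fin e1) =>
        ψ (i.1.1, i.2, x1, i.1.2.1, i.1.2.2))
      (fun i (f : Fin f1' × S1.R) => Φ1 i.1 i.2 f.1 f.2) (fun x y => by rw [m1]; rfl)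
    obtain ⟨W2, w2, w2'⟩ := exists_W
      (fun (i : (Fin a × Fin b1 × Fin e1) × Fin b2) (x2 : Fin e2) =>
        ψ (i.1.1, i.1.2.1, i.1.2.2, i.2, x2))
      (fun i (f : Fin f2' × S2.R) => Φ2 i.1 i.2 f.1 f.2) (fun x y => by rw [m2]; rfl)
    obtain ⟨Ψ, hΨ⟩ : ∃ Ψ : Fin a → Fin b1 → Fin b2 → Fin f1' → S1.R → Fin f2' → S2.R → ℂ,
      Ψ = fun a b1 b2 k1 r1 k2 r2 => ∑ x2, W2 x2 (k2, r2) * Φ1 (a, b2, x2) b1 k1 r1 := ⟨_, rfl⟩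
    have p1 : ∀ a b1 b2 k1 r1 k2 r2, Ψ a b1 b2 k1 r1 k2 r2 =
        ∑ x2, W2 x2 (k2, r2) * Φ1 (a, b2, x2) b1 k1 r1 := by
      intros; rw [hΨ]
    have p2 : ∀ a b1 b2 k1 r1 k2 r2, Ψ a b1 b2 k1 r1 k2 r2 =
        ∑ x1, W1 x1 (k1, r1) * Φ2 (a, b1, x1) b2 k2 r2 := by
      intro a b1 b2 k1 r1 k2 r2
      rw [p1]
      have u1 := fun x2 => w1 ((a, b2, x2), b1) (k1, r1)
      have u2 := fun x1 => w2 ((a, b1, x1), b2) (k2, r2)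
      simp only at u1 u2
      simp only [u1, u2, Finset.mul_sum]
      rw [Finset.sum_comm]
      refine Finset.sum_congr rfl fun x1 _ => Finset.sum_congr rfl fun x2 _ => ?_
      ring
    have p1' : ∀ a b1 b2 k1 r1 x2, Φ1 (a, b2, x2) b1 k1 r1 =
        ∑ f : Fin f2' × S2.R, star (W2 x2 f) * Ψ a b1 b2 k1 r1 f.1 f.2 := by
      intro a b1 b2 k1 r1 x2
      have u1 := w1 ((a, b2, x2), b1) (k1, r1)
      have u2 := fun x1 => w2' ((a, b1, x1), b2) x2
      simp only at u1 u2
      rw [u1]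
      simp only [u2, p2, Finset.mul_sum]
      rw [Finset.sum_comm]
      refine Finset.sum_congr rfl fun x1 _ => Finset.sum_congr rfl fun x2 _ => ?_
      ring
    have p2' : ∀ a b1 b2 k2 r2 x1, Φ2 (a, b1, x1) b2 k2 r2 =
        ∑ f : Fin f1' × S1.R, star (W1 x1 f) * Ψ a b1 b2 f.1 f.2 k2 r2 := by
      intro a b1 b2 k2 r2 x1
      have u1 := w2 ((a, b1, x1), b2) (k2, r2)
      have u2 := fun x2 => w1' ((a, b2, x2), b1) x1
      simp only at u1 u2
      rw [u1]
      simp only [u2, p1, Finset.mul_sum]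
      rw [Finset.sum_comm]
      refine Finset.sum_congr rfl fun x1 _ => Finset.sum_congr rfl fun x2 _ => ?_
      ring
    have c1 : cm (fun (x : (Fin a × Fin b2) × (Fin f2' × S2.R)) b1 k1 r1 =>
        Ψ x.1.1 b1 x.1.2 k1 r1 x.2.1 x.2.2) = cm Φ1 :=
      (cm_iso (fun (x : (Fin a × Fin b2) × Fin e2) b1 k1 r1 => Φ1 (x.1.1, x.1.2, x.2) b1 k1 r1) _
        W2 (fun _ _ _ _ _ => p1 _ _ _ _ _ _ _) (fun _ _ _ _ _ => p1' _ _ _ _ _ _)).trans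
        (cm_reindexA Φ1 (Equiv.prodAssoc _ _ _))
    have c2 : cm (fun (x : (Fin a × Fin b1) × (Fin f1' × S1.R)) b2 k2 r2 =>
        Ψ x.1.1 x.1.2 b2 x.2.1 x.2.2 k2 r2) = cm Φ2 :=
      (cm_iso (fun (x : (Fin a × Fin b1) × Fin e1) b2 k2 r2 => Φ2 (x.1.1, x.1.2, x.2) b2 k2 r2) _
        W1 (fun _ _ _ _ _ => p2 _ _ _ _ _ _ _) (fun _ _ _ _ _ => p2' _ _ _ _ _ _)).trans
        (cm_reindexA Φ2 (Equiv.prodAssoc _ _ _))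
    have hm := main_ineq Ψ
    rw [c1, c2] at hm
    refine le_trans (csInf_le (EsqSet_bdd _) ?_) hm
    rw [← cm_reindex _ (finProdFinEquiv (m := f1') (n := f2')).symm]
    refine mem_EsqSet _ _ fun x y => ?_
    have q1 : ∀ g1 : Fin f1' × S1.R, ∑ g2 : Fin f2' × S2.R,
        Ψ x.1 x.2.1 x.2.2 g1.1 g1.2 g2.1 g2.2 * star (Ψ y.1 y.2.1 y.2.2 g1.1 g1.2 g2.1 g2.2) =
        ∑ x2, Φ1 (x.1, x.2.2, x2) x.2.1 g1.1 g1.2 * star (Φ1 (y.1, y.2.2, x2) y.2.1 g1.1 g1.2) :=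
      fun g1 => iso_sum _ _ _ _ W2 (fun _ => p1 _ _ _ _ _ _ _) (fun _ => p1' _ _ _ _ _ _)
    have q2 : ∑ g1 : Fin f1' × S1.R, ∑ g2 : Fin f2' × S2.R,
        Ψ x.1 x.2.1 x.2.2 g1.1 g1.2 g2.1 g2.2 * star (Ψ y.1 y.2.1 y.2.2 g1.1 g1.2 g2.1 g2.2) =
        ρ0 x y := by
      simp only [q1]
      rw [Finset.sum_comm]
      have := fun x2 => m1 ((x.1, x.2.2, x2), x.2.1) ((y.1, y.2.2, x2), y.2.1)
      simp only at this
      simp only [this, hρ1, hρ0, Matrix.of_apply]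
      rw [Finset.sum_comm]
    rw [← q2, ← Fintype.sum_prod_type']
    let g : (Fin (f1' * f2') × (S1.R × S2.R)) ≃ (Fin f1' × S1.R) × (Fin f2' × S2.R) :=
      (Equiv.prodCongr finProdFinEquiv.symm (Equiv.refl _)).trans (Equiv.prodProdProdComm _ _ _ _)
    exact g.sum_comp (fun z : (Fin f1' × S1.R) × (Fin f2' × S2.R) =>
      Ψ x.1 x.2.1 x.2.2 z.1.1 z.1.2 z.2.1 z.2.2 * star (Ψ y.1 y.2.1 y.2.2 z.1.1 z.1.2 z.2.1 z.2.2))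
  have k1 : ∀ y ∈ EsqSet ρ2, sInf (EsqSet ρ0) - y ≤ sInf (EsqSet ρ1) := fun y hy =>
    le_csInf ne1 fun x hx => by linarith [key x hx y hy]
  have k2 : sInf (EsqSet ρ0) - sInf (EsqSet ρ1) ≤ sInf (EsqSet ρ2) :=
    le_csInf ne2 fun y hy => by linarith [k1 y hy]
  change 1 / 2 * sInf (EsqSet ρ0) ≤ 1 / 2 * sInf (EsqSet ρ1) + 1 / 2 * sInf (EsqSet ρ2)
  linarith
end

section
/- The squashed entanglement of a quantum channel N is at most its entanglement of formation maximized over pure inputs: for every pure input state φ_{AA'}, E_sq(A;B) on (id ⊗ N)(φ) is at most E_F(A;B) on the same state, where E_F is the entanglement of formation. In particular E_sq(N) ≤ max_φ E_F(A;B). -/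
open Matrix BigOperators
open scoped Kronecker

/-- Apply a channel to the second subsystem (the channel input A'), keeping a reference A. -/
noncomputable def applyOnSnd {A ι κ : Type} [Fintype A] [Fintype ι] [Fintype κ]
    [DecidableEq A] [DecidableEq ι] (N : Kraus ι κ) (ρ : Matrix (A × ι) (A × ι) ℂ) :
    Matrix (A × κ) (A × κ) ℂ :=
  ∑ i : N.R, ((1 : Matrix A A ℂ) ⊗ₖ N.K i) * ρ * ((1 : Matrix A A ℂ) ⊗ₖ N.K i)ᴴ

/-- The squashed entanglement of a quantum channel. -/
noncomputable def EsqChan {ι κ : Type} [Fintype ι] [Fintype κ] [DecidableEq ι] [DecidableEq κ]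
    (N : Kraus ι κ) : ℝ :=
  sSup { x : ℝ | ∃ (a : ℕ) (φ : Fin a × ι → ℂ), (∑ i, Complex.normSq (φ i) = 1) ∧
    x = EsqState (applyOnSnd N (pureMat φ)) }

/-- Entanglement of formation: minimum over pure-state decompositions
ρ = Σ_x p(x)|ψ_x⟩⟨ψ_x| of Σ_x p(x) H(Tr_B ψ_x). -/
noncomputable def EF {A B : Type} [Fintype A] [Fintype B] [DecidableEq A] [DecidableEq B]
    (ρ : Matrix (A × B) (A × B) ℂ) : ℝ :=
  sInf { x : ℝ | ∃ (n : ℕ) (p : Fin n → ℝ) (ψ : Fin n → (A × B) → ℂ),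
    (∀ i, 0 ≤ p i) ∧ (∑ i, p i = 1) ∧ (∀ i, ∑ j, Complex.normSq (ψ i j) = 1) ∧
    ρ = ∑ i, (p i : ℂ) • pureMat (ψ i) ∧ x = ∑ i, p i * vnH (ptSnd (pureMat (ψ i))) }

noncomputable def eta (x : ℝ) : ℝ := Real.negMulLog x / Real.log 2

lemma eta_zero : eta 0 = 0 := by simp [eta]

lemma eta_mul (x y : ℝ) : eta (x * y) = y * eta x + x * eta y := by
  simp only [eta, Real.negMulLog_mul]; ring

noncomputable def cpH {n : Type} [Fintype n] [DecidableEq n] (M : Matrix n n ℂ) : ℝ :=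
  (M.charpoly.roots.map (fun z => eta z.re)).sum

lemma vnH_eq {n : Type} [Fintype n] [DecidableEq n] {M : Matrix n n ℂ} (h : M.IsHermitian) :
    vnH M = ∑ i, eta (h.eigenvalues i) := by
  rw [vnH, dif_pos h, ← Finset.sum_neg_distrib]
  refine Finset.sum_congr rfl fun i _ => ?_
  simp only [eta, Real.negMulLog, Real.logb]; ring

lemma vnH_eq_cpH {n : Type} [Fintype n] [DecidableEq n] {M : Matrix n n ℂ} (h : M.IsHermitian) :
    vnH M = cpH M := by
  rw [vnH_eq h, cpH, h.roots_charpoly_eq_eigenvalues]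
  simp [Multiset.map_map]

lemma cpH_mul_comm {m n : Type} [Fintype n] [DecidableEq n] [Fintype m] [DecidableEq m]
    (A : Matrix m n ℂ) (B : Matrix n m ℂ) : cpH (A * B) = cpH (B * A) := by
  have h := congrArg (fun p : Polynomial ℂ => (p.roots.map (fun z => eta z.re)).sum)
    (Matrix.charpoly_mul_comm' A B)
  rw [Polynomial.roots_mul (mul_ne_zero (pow_ne_zero _ Polynomial.X_ne_zero)
      (Matrix.charpoly_monic _).ne_zero),
    Polynomial.roots_mul (mul_ne_zero (pow_ne_zero _ Polynomial.X_ne_zero)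
      (Matrix.charpoly_monic _).ne_zero)] at h
  simpa [Multiset.map_nsmul, Multiset.sum_nsmul, eta_zero, cpH] using h

lemma cpH_transpose {n : Type} [Fintype n] [DecidableEq n] (M : Matrix n n ℂ) :
    cpH Mᵀ = cpH M := by
  rw [cpH, Matrix.charpoly_transpose, cpH]

lemma cpH_diagonal {n : Type} [Fintype n] [DecidableEq n] (d : n → ℂ) :
    cpH (diagonal d) = ∑ i, eta (d i).re := by
  rw [cpH, Matrix.charpoly_diagonal, Polynomial.roots_prod]
  · simp
  · simp [Finset.prod_ne_zero_iff, Polynomial.X_sub_C_ne_zero]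

lemma cpH_submatrix {m n : Type} [Fintype n] [DecidableEq n] [Fintype m] [DecidableEq m]
    (e : m ≃ n) (M : Matrix n n ℂ) : cpH (M.submatrix e e) = cpH M := by
  have := Matrix.charpoly_reindex e.symm M
  simp only [Matrix.reindex_apply, Equiv.symm_symm] at this
  rw [cpH, this, cpH]

lemma cpH_blockDiagonal {n o : Type} [Fintype n] [DecidableEq n] [Fintype o] [DecidableEq o]
    (M : o → Matrix n n ℂ) : cpH (blockDiagonal M) = ∑ i, cpH (M i) := by
  have h : (blockDiagonal M).charpoly = ∏ i, (M i).charpoly := by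
    simp only [Matrix.charpoly]
    rw [← Matrix.det_blockDiagonal]
    congr 1
    ext1 ⟨i, k⟩ ⟨j, l⟩
    simp only [Matrix.charmatrix_apply, Matrix.blockDiagonal_apply, Matrix.diagonal_apply,
      Prod.mk.injEq]
    by_cases hk : k = l <;> simp [hk]
  rw [cpH, h, Polynomial.roots_prod]
  · simp [Multiset.map_bind, Multiset.sum_bind, cpH]
  · simp [Finset.prod_ne_zero_iff, (Matrix.charpoly_monic _).ne_zero]

lemma cpH_smul {n : Type} [Fintype n] [DecidableEq n] {M : Matrix n n ℂ} (h : M.IsHermitian)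
    (p : ℝ) : cpH ((p : ℂ) • M) = p * cpH M + eta p * M.trace.re := by
  have h1 : cpH ((p : ℂ) • M) = ∑ i, eta (p * h.eigenvalues i) := by
    conv_lhs => rw [h.spectral_theorem, Unitary.conjStarAlgAut_apply]
    rw [← Matrix.smul_mul, ← Matrix.mul_smul, cpH_mul_comm, ← mul_assoc]
    simp only [Unitary.coe_star_mul_self, one_mul]
    rw [← Matrix.diagonal_smul, cpH_diagonal]
    simp
  rw [h1, ← vnH_eq_cpH h, vnH_eq h, h.trace_eq_sum_eigenvalues, Finset.mul_sum]
  simp only [eta_mul, Finset.sum_add_distrib, Complex.re_sum]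
  rw [Finset.mul_sum, add_comm]
  simp [mul_comm]

lemma herm_pureMat {n : Type} (ψ : n → ℂ) : (pureMat ψ).IsHermitian := by
  ext i j; simp [pureMat, mul_comm]

lemma cpH_pureMat {n : Type} [Fintype n] [DecidableEq n] (ψ : n → ℂ) :
    cpH (pureMat ψ) = eta (∑ i, Complex.normSq (ψ i)) := by
  have h : pureMat ψ = replicateCol Unit ψ * replicateRow Unit (star ψ) := by
    ext i j; simp [pureMat, Matrix.mul_apply]
  have h2 : replicateRow Unit (star ψ) * replicateCol Unit ψ =
      diagonal (fun _ : Unit => ((∑ i, Complex.normSq (ψ i) : ℝ) : ℂ)) := by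
    ext i j
    simp [Matrix.mul_apply, Complex.normSq_eq_conj_mul_self]
  rw [h, cpH_mul_comm, h2, cpH_diagonal]
  simp

lemma ptSnd_eq {A B : Type} [Fintype A] [Fintype B] (ψ : A × B → ℂ) :
    ptSnd (pureMat ψ) = (Matrix.of fun a b => ψ (a, b)) * (Matrix.of fun a b => ψ (a, b))ᴴ := by
  ext i j; simp [ptSnd, pureMat, Matrix.mul_apply]

lemma ptFst_eq {A B : Type} [Fintype A] [Fintype B] (ψ : A × B → ℂ) :
    ptFst (pureMat ψ) = (Matrix.of fun b a => ψ (a, b)) * (Matrix.of fun b a => ψ (a, b))ᴴ := by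
  ext i j; simp [ptFst, pureMat, Matrix.mul_apply]

open scoped ComplexOrder in
lemma psd_ptSnd {A B : Type} [Fintype A] [Fintype B] (ψ : A × B → ℂ) :
    (ptSnd (pureMat ψ)).PosSemidef := by
  rw [ptSnd_eq]; exact Matrix.posSemidef_self_mul_conjTranspose _

open scoped ComplexOrder in
lemma psd_ptFst {A B : Type} [Fintype A] [Fintype B] (ψ : A × B → ℂ) :
    (ptFst (pureMat ψ)).PosSemidef := by
  rw [ptFst_eq]; exact Matrix.posSemidef_self_mul_conjTranspose _

lemma cpH_ptFst {A B : Type} [Fintype A] [Fintype B] [DecidableEq A] [DecidableEq B]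
    (ψ : A × B → ℂ) : cpH (ptFst (pureMat ψ)) = cpH (ptSnd (pureMat ψ)) := by
  rw [ptSnd_eq, cpH_mul_comm, ← cpH_transpose]
  congr 1
  ext i j; simp [ptFst, pureMat, Matrix.mul_apply, mul_comm]

lemma trace_ptSnd {A B : Type} [Fintype A] [Fintype B] (ψ : A × B → ℂ) :
    (ptSnd (pureMat ψ)).trace = ((∑ i, Complex.normSq (ψ i) : ℝ) : ℂ) := by
  simp [ptSnd, pureMat, Matrix.trace, Fintype.sum_prod_type, Complex.mul_conj]

open scoped ComplexOrder in
lemma vnH_ptSnd_nonneg {A B : Type} [Fintype A] [Fintype B] [DecidableEq A]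
    (ψ : A × B → ℂ) (h : ∑ i, Complex.normSq (ψ i) = 1) : 0 ≤ vnH (ptSnd (pureMat ψ)) := by
  have hp := psd_ptSnd ψ
  rw [vnH_eq hp.1]
  have ht := trace_ptSnd ψ
  rw [hp.1.trace_eq_sum_eigenvalues, h] at ht
  have ht' : ∑ i, hp.1.eigenvalues i = 1 := by
    have := congrArg Complex.re ht
    simpa [Complex.re_sum] using this
  refine Finset.sum_nonneg fun i _ => div_nonneg (Real.negMulLog_nonneg (hp.eigenvalues_nonneg i) ?_)
    (Real.log_nonneg (by norm_num))
  rw [← ht']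
  exact Finset.single_le_sum (fun i _ => hp.eigenvalues_nonneg i) (Finset.mem_univ i)

open scoped ComplexOrder in
lemma vnH_ptSnd_le {A B : Type} [Fintype A] [Fintype B] [DecidableEq A] [DecidableEq B]
    (ψ : A × B → ℂ) : vnH (ptSnd (pureMat ψ)) ≤ Fintype.card B * (1 / Real.log 2) := by
  have hp := psd_ptFst ψ
  rw [vnH_eq_cpH (psd_ptSnd ψ).1, ← cpH_ptFst, ← vnH_eq_cpH hp.1, vnH_eq hp.1]
  have : ∀ i ∈ Finset.univ, eta (hp.1.eigenvalues i) ≤ 1 / Real.log 2 := fun i _ => by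
    have h0 := hp.eigenvalues_nonneg i
    refine div_le_div_of_nonneg_right ?_ (Real.log_nonneg (by norm_num))
    linarith [Real.negMulLog_le_one_sub_self h0]
  simpa using Finset.sum_le_sum this

/-- The measuring channel. -/
noncomputable def measK (n : ℕ) : Kraus (Fin n) (Fin n) where
  R := Fin n
  fintypeR := inferInstance
  K := fun i => diagonal (Pi.single i 1)
  tp := by
    ext a b
    simp only [Matrix.diagonal_conjTranspose, Matrix.diagonal_mul_diagonal, Matrix.sum_apply,
      Matrix.diagonal_apply, Matrix.one_apply]
    by_cases h : a = b
    · subst h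
      simp [Pi.single_apply]
    · simp [h]

lemma squash_meas {A B : Type} [Fintype A] [Fintype B] [DecidableEq A] [DecidableEq B]
    {n : ℕ} (χ : Fin n → A × B → ℂ) :
    squash (pureMat fun x : (A × B) × Fin n => χ x.2 x.1) (measK n) =
      (blockDiagonal fun i => pureMat (χ i)).submatrix
        (Equiv.prodAssoc A B (Fin n)).symm (Equiv.prodAssoc A B (Fin n)).symm := by
  unfold squash
  congr 1
  have hk : ∀ i : (measK n).R, ((1 : Matrix (A × B) (A × B) ℂ) ⊗ₖ (measK n).K i) =
      diagonal (fun x : (A × B) × Fin n => (Pi.single (M := fun _ => ℂ) (show Fin n from i) 1) x.2) := by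
    intro i
    ext ⟨x, k⟩ ⟨y, l⟩
    simp only [measK, Matrix.kroneckerMap_apply, Matrix.one_apply, Matrix.diagonal_apply,
      Prod.mk.injEq]
    by_cases h1 : x = y <;> by_cases h2 : k = l <;> simp [h1, h2]
  simp only [hk, Matrix.diagonal_conjTranspose]
  ext ⟨x, k⟩ ⟨y, l⟩
  rw [Matrix.sum_apply]
  simp only [Matrix.diagonal_mul, Matrix.mul_diagonal, Matrix.blockDiagonal_apply]
  change ∑ i : Fin n, _ = _
  by_cases h : k = l
  · subst h
    simp [pureMat, Pi.single_apply, apply_ite]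
  · simp only [h, if_false]
    refine Finset.sum_eq_zero fun i _ => ?_
    by_cases h3 : k = i
    · have : l ≠ i := fun h4 => h (h3.trans h4.symm)
      simp [Pi.single_apply, this]
    · simp [Pi.single_apply, h3]

lemma herm_block {n o : Type} [DecidableEq o] (M : o → Matrix n n ℂ)
    (h : ∀ i, (M i).IsHermitian) : (blockDiagonal M).IsHermitian := by
  unfold Matrix.IsHermitian
  rw [Matrix.blockDiagonal_conjTranspose]
  congr 1; funext i; exact h i

lemma cmi_meas {A B : Type} [Fintype A] [Fintype B] [DecidableEq A] [DecidableEq B]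
    {n : ℕ} (χ : Fin n → A × B → ℂ) :
    cmi (squash (pureMat fun x : (A × B) × Fin n => χ x.2 x.1) (measK n)) =
      2 * ∑ i, cpH (ptSnd (pureMat (χ i))) - 2 * ∑ i, eta (∑ j, Complex.normSq (χ i j)) := by
  rw [squash_meas, cmi]
  set ρ := (blockDiagonal fun i => pureMat (χ i)).submatrix
        (Equiv.prodAssoc A B (Fin n)).symm (Equiv.prodAssoc A B (Fin n)).symm with hρ
  have e1 : ptMid ρ = blockDiagonal fun i => ptSnd (pureMat (χ i)) := by
    ext ⟨x, k⟩ ⟨y, l⟩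
    by_cases h : k = l <;>
    simp [hρ, ptMid, ptSnd, Matrix.blockDiagonal_apply, h]
  have e2 : ptFst ρ = blockDiagonal fun i => ptFst (pureMat (χ i)) := by
    ext ⟨x, k⟩ ⟨y, l⟩
    by_cases h : k = l <;>
    simp [hρ, ptFst, Matrix.blockDiagonal_apply, h]
  have e3 : ptFst (ptFst ρ) =
      diagonal fun i => ((∑ j, Complex.normSq (χ i j) : ℝ) : ℂ) := by
    rw [e2]
    ext k l
    by_cases h : k = l
    · subst h
      simp [ptFst, Matrix.blockDiagonal_apply, pureMat, Complex.mul_conj, Fintype.sum_prod_type]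
      rw [Finset.sum_comm]
    · simp [ptFst, Matrix.blockDiagonal_apply, h]
  have h0 : vnH ρ = ∑ i, eta (∑ j, Complex.normSq (χ i j)) := by
    rw [vnH_eq_cpH ((herm_block _ fun i => herm_pureMat (χ i)).submatrix _), cpH_submatrix,
      cpH_blockDiagonal]
    simp only [cpH_pureMat]
  have h3 : vnH (ptFst (ptFst ρ)) = ∑ i, eta (∑ j, Complex.normSq (χ i j)) := by
    rw [e3, vnH_eq_cpH, cpH_diagonal]
    · simp only [Complex.ofReal_re]
    · ext i j
      by_cases h : i = j
      · subst h; simp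
      · simp [h, Ne.symm h]
  rw [h0, h3, e1, e2, vnH_eq_cpH (herm_block _ fun i => (psd_ptSnd (χ i)).1),
    vnH_eq_cpH (herm_block _ fun i => (psd_ptFst (χ i)).1), cpH_blockDiagonal, cpH_blockDiagonal]
  simp only [cpH_ptFst]
  ring

lemma pureMat_smul {n : Type} (p : ℝ) (hp : 0 ≤ p) (ψ : n → ℂ) :
    pureMat (fun j => (Real.sqrt p : ℂ) * ψ j) = (p : ℂ) • pureMat ψ := by
  ext i j
  have : (Real.sqrt p : ℂ) * (Real.sqrt p : ℂ) = p := by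
    rw [← Complex.ofReal_mul, Real.mul_self_sqrt hp]
  simp only [pureMat, Matrix.of_apply, Matrix.smul_apply, smul_eq_mul, star_mul']
  rw [← this]
  simp
  ring

lemma normSq_smul {n : Type} [Fintype n] (p : ℝ) (hp : 0 ≤ p) (ψ : n → ℂ) :
    ∑ j, Complex.normSq ((Real.sqrt p : ℂ) * ψ j) = p * ∑ j, Complex.normSq (ψ j) := by
  simp [Complex.normSq_mul, Finset.mul_sum, Real.mul_self_sqrt hp]

lemma Esq_le_of_decomp {A B : Type} [Fintype A] [Fintype B] [DecidableEq A] [DecidableEq B]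
    (ρ : Matrix (A × B) (A × B) ℂ) (n : ℕ) (p : Fin n → ℝ) (ψ : Fin n → (A × B) → ℂ)
    (hp : ∀ i, 0 ≤ p i) (hψ : ∀ i, ∑ j, Complex.normSq (ψ i j) = 1)
    (hρ : ρ = ∑ i, (p i : ℂ) • pureMat (ψ i)) :
    EsqState ρ ≤ ∑ i, p i * vnH (ptSnd (pureMat (ψ i))) := by
  unfold EsqState
  set S := { x : ℝ | ∃ (e : ℕ) (ψ : (A × B) × Fin e → ℂ),
    ptSnd (pureMat ψ) = ρ ∧ ∃ (e' : ℕ) (S : Kraus (Fin e) (Fin e')),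
      x = cmi (squash (pureMat ψ) S) } with hS
  by_cases hb : BddBelow S
  · let χ : Fin n → A × B → ℂ := fun i j => (Real.sqrt (p i) : ℂ) * ψ i j
    have hmem : 2 * ∑ i, p i * vnH (ptSnd (pureMat (ψ i))) ∈ S := by
      refine ⟨n, fun x => χ x.2 x.1, ?_, n, measK n, ?_⟩
      · rw [hρ]
        have : ∀ i, (p i : ℂ) • pureMat (ψ i) = pureMat (χ i) :=
          fun i => (pureMat_smul _ (hp i) _).symm
        simp only [this]
        ext x y
        simp [ptSnd, pureMat, Matrix.sum_apply]
      · rw [cmi_meas, ← mul_sub, ← Finset.sum_sub_distrib]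
        congr 1
        refine Finset.sum_congr rfl fun i _ => ?_
        have hH := (psd_ptSnd (ψ i)).1
        have h1 : ptSnd (pureMat (χ i)) = (p i : ℂ) • ptSnd (pureMat (ψ i)) := by
          simp only [χ, pureMat_smul _ (hp i)]
          ext x y
          simp [ptSnd, Finset.mul_sum]
        rw [h1, cpH_smul hH, trace_ptSnd, hψ, vnH_eq_cpH hH]
        simp only [χ, normSq_smul _ (hp i), hψ]
        simp
    have := csInf_le hb hmem
    linarith
  · rw [Real.sInf_of_not_bddBelow hb, mul_zero]
    exact Finset.sum_nonneg fun i _ => mul_nonneg (hp i) (vnH_ptSnd_nonneg _ (hψ i))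

lemma exists_decomp {ι κ : Type} [Fintype ι] [Fintype κ] [DecidableEq ι] [DecidableEq κ]
    (N : Kraus ι κ) (a : ℕ) (φ : Fin a × ι → ℂ) (hφ : ∑ i, Complex.normSq (φ i) = 1) :
    ∃ (n : ℕ) (p : Fin n → ℝ) (ψ : Fin n → (Fin a × κ) → ℂ),
    (∀ i, 0 ≤ p i) ∧ (∑ i, p i = 1) ∧ (∀ i, ∑ j, Complex.normSq (ψ i j) = 1) ∧
    applyOnSnd N (pureMat φ) = ∑ i, (p i : ℂ) • pureMat (ψ i) := by
  let M : N.R → Matrix (Fin a × κ) (Fin a × ι) ℂ := fun r => (1 : Matrix (Fin a) (Fin a) ℂ) ⊗ₖ N.K r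
  let v : N.R → (Fin a × κ) → ℂ := fun r => M r *ᵥ φ
  let q : N.R → ℝ := fun r => ∑ j, Complex.normSq (v r j)
  have hq0 : ∀ r, 0 ≤ q r := fun r => Finset.sum_nonneg fun j _ => Complex.normSq_nonneg _
  have hM : ∑ r, (M r)ᴴ * M r = 1 := by
    simp only [M, Matrix.conjTranspose_kronecker, ← Matrix.mul_kronecker_mul,
      Matrix.conjTranspose_one, one_mul]
    rw [← Matrix.one_kronecker_one, ← N.tp]
    ext x y
    simp [Matrix.sum_apply, Matrix.kroneckerMap_apply, Finset.mul_sum]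
  have hsum : ∑ r, q r = 1 := by
    have h1 : ∀ r, ((q r : ℝ) : ℂ) = star φ ⬝ᵥ (((M r)ᴴ * M r) *ᵥ φ) := by
      intro r
      rw [← Matrix.mulVec_mulVec, Matrix.dotProduct_mulVec, ← Matrix.star_mulVec]
      simp [q, v, dotProduct, Complex.normSq_eq_conj_mul_self]
    have h2 : ((∑ r, q r : ℝ) : ℂ) = 1 := by
      rw [Complex.ofReal_sum]
      simp only [h1]
      rw [← dotProduct_sum, ← Matrix.sum_mulVec, hM, Matrix.one_mulVec]
      have : ((∑ i, Complex.normSq (φ i) : ℝ) : ℂ) = 1 := by rw [hφ]; simp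
      rw [← this]
      simp [dotProduct, Complex.normSq_eq_conj_mul_self]
    exact_mod_cast h2
  have hdec : applyOnSnd N (pureMat φ) = ∑ r, pureMat (v r) := by
    unfold applyOnSnd
    refine Finset.sum_congr rfl fun r _ => ?_
    have : ∀ {n : Type} (f : n → ℂ), pureMat f = vecMulVec f (star f) := fun f => by
      ext; simp [pureMat, vecMulVec_apply]
    rw [this, this, Matrix.mul_vecMulVec, Matrix.vecMulVec_mul, Matrix.star_mulVec]
  have hunit : ∀ r, q r ≠ 0 → ∃ w : (Fin a × κ) → ℂ, ∑ j, Complex.normSq (w j) = 1 ∧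
      pureMat (v r) = (q r : ℂ) • pureMat w := by
    intro r hr
    have hi : 0 ≤ (q r)⁻¹ := inv_nonneg.2 (hq0 r)
    refine ⟨fun j => (Real.sqrt (q r)⁻¹ : ℂ) * v r j, ?_, ?_⟩
    · rw [normSq_smul _ hi]; exact inv_mul_cancel₀ hr
    · rw [pureMat_smul _ hi, smul_smul, ← Complex.ofReal_mul, mul_inv_cancel₀ hr]; simp
  have hex : ∃ r, q r ≠ 0 := by
    by_contra! h
    simp [h] at hsum
  obtain ⟨r0, hr0⟩ := hex
  obtain ⟨w0, hw0, -⟩ := hunit r0 hr0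
  have hall : ∀ r, ∃ w : (Fin a × κ) → ℂ, ∑ j, Complex.normSq (w j) = 1 ∧
      pureMat (v r) = (q r : ℂ) • pureMat w := by
    intro r
    by_cases hr : q r = 0
    · refine ⟨w0, hw0, ?_⟩
      have hv : ∀ j, v r j = 0 := fun j => Complex.normSq_eq_zero.1
        ((Finset.sum_eq_zero_iff_of_nonneg fun j _ => Complex.normSq_nonneg _).1 hr j
          (Finset.mem_univ j))
      ext i j
      simp [pureMat, hr, hv]
    · exact hunit r hr
  choose w hw1 hw2 using hall
  let e := (Fintype.equivFin N.R).symm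
  refine ⟨Fintype.card N.R, fun i => q (e i), fun i => w (e i), fun i => hq0 _, ?_,
    fun i => hw1 _, ?_⟩
  · rw [Equiv.sum_comp e q]; exact hsum
  · rw [hdec, Equiv.sum_comp e (fun r => (q r : ℂ) • pureMat (w r))]
    exact Finset.sum_congr rfl fun r _ => hw2 r

/-- **Squashed entanglement is at most entanglement of formation**: for every pure input,
E_sq(A;B) of the channel output is at most E_F(A;B) of the same state; in particular the
channel squashed entanglement is bounded by the maximal output entanglement of formation. -/
theorem EsqState_le_EF {ι κ : Type} [Fintype ι] [Fintype κ] [DecidableEq ι] [DecidableEq κ]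
    (N : Kraus ι κ) :
    (∀ (a : ℕ) (φ : Fin a × ι → ℂ), (∑ i, Complex.normSq (φ i) = 1) →
      EsqState (applyOnSnd N (pureMat φ)) ≤ EF (applyOnSnd N (pureMat φ))) ∧
    EsqChan N ≤ sSup { x : ℝ | ∃ (a : ℕ) (φ : Fin a × ι → ℂ),
      (∑ i, Complex.normSq (φ i) = 1) ∧ x = EF (applyOnSnd N (pureMat φ)) } := by
  have key : ∀ (a : ℕ) (φ : Fin a × ι → ℂ), (∑ i, Complex.normSq (φ i) = 1) →
      EsqState (applyOnSnd N (pureMat φ)) ≤ EF (applyOnSnd N (pureMat φ)) := by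
    intro a φ hφ
    obtain ⟨n, p, ψ, h1, h2, h3, h4⟩ := exists_decomp N a φ hφ
    refine le_csInf ⟨_, n, p, ψ, h1, h2, h3, h4, rfl⟩ ?_
    rintro x ⟨n, p, ψ, h1, h2, h3, h4, rfl⟩
    exact Esq_le_of_decomp _ n p ψ h1 h3 h4
  refine ⟨key, ?_⟩
  have hbdd : BddAbove { x : ℝ | ∃ (a : ℕ) (φ : Fin a × ι → ℂ),
      (∑ i, Complex.normSq (φ i) = 1) ∧ x = EF (applyOnSnd N (pureMat φ)) } := by
    refine ⟨Fintype.card κ * (1 / Real.log 2), ?_⟩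
    rintro x ⟨a, φ, hφ, rfl⟩
    obtain ⟨n, p, ψ, h1, h2, h3, h4⟩ := exists_decomp N a φ hφ
    refine le_trans (b := ∑ i, p i * vnH (ptSnd (pureMat (ψ i))))
      (csInf_le ⟨0, ?_⟩ ⟨n, p, ψ, h1, h2, h3, h4, rfl⟩) ?_
    · rintro x ⟨n, p, ψ, h1, h2, h3, h4, rfl⟩
      exact Finset.sum_nonneg fun i _ => mul_nonneg (h1 i) (vnH_ptSnd_nonneg _ (h3 i))
    · calc _ ≤ ∑ i, p i * (Fintype.card κ * (1 / Real.log 2)) :=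
            Finset.sum_le_sum fun i _ => mul_le_mul_of_nonneg_left (vnH_ptSnd_le _) (h1 i)
        _ = _ := by rw [← Finset.sum_mul, h2, one_mul]
  unfold EsqChan
  by_cases hne : { x : ℝ | ∃ (a : ℕ) (φ : Fin a × ι → ℂ), (∑ i, Complex.normSq (φ i) = 1) ∧
    x = EsqState (applyOnSnd N (pureMat φ)) }.Nonempty
  · refine csSup_le hne ?_
    rintro x ⟨a, φ, hφ, rfl⟩
    exact (key a φ hφ).trans (le_csSup hbdd ⟨a, φ, hφ, rfl⟩)
  · have he : ∀ (a : ℕ) (φ : Fin a × ι → ℂ), ¬ (∑ i, Complex.normSq (φ i) = 1) :=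
      fun a φ hφ => hne ⟨_, a, φ, hφ, rfl⟩
    simp [he]
end
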